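/- Let A and B be homogeneous constant-coefficient linear differential operators on ℝ^n of orders k and l respectively (A from W to X, B from V to W), both of constant rank, with ker A(ξ) = im B(ξ) for all ξ ∈ ℝ^n \ {0}, let f : W → ℝ be Borel measurable and locally bounded, and let α ∈ [0,1). Then for every η ∈ W and every ε > 0, Q_A f(η) = inf{ ∫_{[0,1]^n} f(η + B u(x)) dx : u ∈ C_c^∞((0,1)^n, V), ‖u‖_{C^{l−1,α}} < ε }, where Q_A f(η) := inf{ ∫_{[0,1]^n} f(η + w(x)) dx : w smooth, ℤ^n-periodic, A w = 0, ∫_{[0,1]^n} w dx = 0 } and ‖u‖_{C^{l−1,α}} := Σ_{j=0}^{l−1} sup_x |∇^j u(x)| + sup_{x≠y} |∇^{l−1}u(x) − ∇^{l−1}u(y)| / |x−y|^α. -/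

import Mathlib

open MeasureTheory
open scoped BigOperators

/-- First-order partial derivative in the `i`-th coordinate direction. -/
noncomputable def pderivI {n : ℕ} {W : Type*} [NormedAddCommGroup W] [NormedSpace ℝ W]
    (i : Fin n) (f : (Fin n → ℝ) → W) : (Fin n → ℝ) → W :=
  fun x => fderiv ℝ f x (Pi.single i 1)

/-- The iterated partial derivative `∂^α` associated to a multi-index `α : Fin n → ℕ`. -/
noncomputable def partialDerivMulti {n : ℕ} {W : Type*} [NormedAddCommGroup W]
    [NormedSpace ℝ W] (α : Fin n → ℕ) (f : (Fin n → ℝ) → W) : (Fin n → ℝ) → W :=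
  (List.finRange n).foldr (fun i g => (pderivI i)^[α i] g) f

/-- The homogeneous constant-coefficient differential operator
`A w = ∑_{|α| = k} A_α ∂^α w`. -/
noncomputable def diffOp {n : ℕ} {W X : Type*} [NormedAddCommGroup W] [NormedSpace ℝ W]
    [NormedAddCommGroup X] [NormedSpace ℝ X]
    (k : ℕ) (coef : (Fin n → ℕ) → (W →ₗ[ℝ] X)) (f : (Fin n → ℝ) → W) : (Fin n → ℝ) → X :=
  fun x => ∑ α ∈ Finset.Nat.antidiagonalTuple n k, coef α (partialDerivMulti α f x)

/-- The symbol `A(ξ) = ∑_{|α| = k} ξ^α A_α` of the operator `diffOp k coef`. -/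
noncomputable def symbolOf {n : ℕ} {W X : Type*} [NormedAddCommGroup W] [NormedSpace ℝ W]
    [NormedAddCommGroup X] [NormedSpace ℝ X]
    (k : ℕ) (coef : (Fin n → ℕ) → (W →ₗ[ℝ] X)) (ξ : Fin n → ℝ) : W →ₗ[ℝ] X :=
  ∑ α ∈ Finset.Nat.antidiagonalTuple n k, (∏ i, ξ i ^ α i) • coef α

/-- The open unit cube `(0,1)^n`. -/
def openUnitCube (n : ℕ) : Set (Fin n → ℝ) := Set.univ.pi fun _ => Set.Ioo (0 : ℝ) 1

/-- The `C^{l−1,α}` Hölder norm of a function `u` on `ℝ^n` (with the Euclidean norm on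
the domain): `∑_{j=0}^{l−1} sup_x |∇^j u(x)| +
sup_{x ≠ y} |∇^{l−1}u(x) − ∇^{l−1}u(y)| / |x−y|^α`. -/
noncomputable def holderNorm {n : ℕ} {V : Type*} [NormedAddCommGroup V] [NormedSpace ℝ V]
    (l : ℕ) (a : ℝ) (u : EuclideanSpace ℝ (Fin n) → V) : ℝ :=
  (∑ j ∈ Finset.range l, ⨆ x : EuclideanSpace ℝ (Fin n), ‖iteratedFDeriv ℝ j u x‖)
    + ⨆ p : {q : EuclideanSpace ℝ (Fin n) × EuclideanSpace ℝ (Fin n) // q.1 ≠ q.2},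
        ‖iteratedFDeriv ℝ (l - 1) u p.1.1 - iteratedFDeriv ℝ (l - 1) u p.1.2‖
          / ‖p.1.1 - p.1.2‖ ^ a

/-- The `A`-quasiconvex envelope at `η`, as an infimum in `EReal`. -/
noncomputable def QAenv {n k : ℕ} {W X : Type*}
    [NormedAddCommGroup W] [NormedSpace ℝ W] [NormedAddCommGroup X] [NormedSpace ℝ X]
    (Acoef : (Fin n → ℕ) → (W →ₗ[ℝ] X)) (f : W → ℝ) (η : W) : EReal :=
  sInf {y : EReal | ∃ w : (Fin n → ℝ) → W, ContDiff ℝ (⊤ : ℕ∞) w ∧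
    (∀ (x : Fin n → ℝ) (z : Fin n → ℤ), w (x + fun i => (z i : ℝ)) = w x) ∧
    (∀ x : Fin n → ℝ, diffOp k Acoef w x = 0) ∧
    (∫ x in Set.Icc (0 : Fin n → ℝ) 1, w x) = 0 ∧
    y = ((∫ x in Set.Icc (0 : Fin n → ℝ) 1, f (η + w x)) : ℝ)}

/-- The iterated partial derivative along a word of coordinate directions. -/
noncomputable def pderivWord {n : ℕ} {F : Type*} [NormedAddCommGroup F] [NormedSpace ℝ F]
    (L : List (Fin n)) (f : (Fin n → ℝ) → F) : (Fin n → ℝ) → F :=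
  L.foldr pderivI f

/-- The word of coordinate directions listing each `i` exactly `α i` times. -/
def wordOf {n : ℕ} (α : Fin n → ℕ) : List (Fin n) :=
  (List.finRange n).flatMap fun i => List.replicate (α i) i

section Words

variable {n : ℕ} {F G : Type*} [NormedAddCommGroup F] [NormedSpace ℝ F]
  [NormedAddCommGroup G] [NormedSpace ℝ G]

lemma pderivWord_cons (i : Fin n) (L : List (Fin n)) (f : (Fin n → ℝ) → F) :
    pderivWord (i :: L) f = pderivI i (pderivWord L f) := rfl

lemma pderivWord_nil (f : (Fin n → ℝ) → F) : pderivWord [] f = f := rfl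

lemma partialDerivMulti_eq_pderivWord (α : Fin n → ℕ) (f : (Fin n → ℝ) → F) :
    partialDerivMulti α f = pderivWord (wordOf α) f := by
  unfold partialDerivMulti pderivWord wordOf
  induction List.finRange n with
  | nil => rfl
  | cons i M ih =>
    rw [List.foldr_cons, List.flatMap_cons, List.foldr_append, ih]
    generalize List.foldr pderivI f _ = g
    induction α i with
    | zero => rfl
    | succ m ihm => rw [Function.iterate_succ_apply', ihm, List.replicate_succ, List.foldr_cons]

lemma length_wordOf (α : Fin n → ℕ) : (wordOf α).length = ∑ i, α i := by
  simp [wordOf, List.length_flatMap, Fin.sum_univ_def]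

lemma length_wordOf_of_mem {α : Fin n → ℕ} {k : ℕ} (h : α ∈ Finset.Nat.antidiagonalTuple n k) :
    (wordOf α).length = k := by
  rw [length_wordOf, Finset.Nat.mem_antidiagonalTuple.1 h]

lemma prod_map_wordOf (α : Fin n → ℕ) (ξ : Fin n → ℝ) :
    ((wordOf α).map ξ).prod = ∏ i, ξ i ^ α i := by
  rw [Fin.prod_univ_def, wordOf]
  induction List.finRange n with
  | nil => rfl
  | cons i M ih => simp [ih]

lemma diffOp_eq_sum_pderivWord (k : ℕ) (coef : (Fin n → ℕ) → (F →ₗ[ℝ] G))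
    (f : (Fin n → ℝ) → F) (x : Fin n → ℝ) :
    diffOp k coef f x
      = ∑ α ∈ Finset.Nat.antidiagonalTuple n k, coef α (pderivWord (wordOf α) f x) := by
  simp only [diffOp, partialDerivMulti_eq_pderivWord]

lemma ContDiff.pderivI {f : (Fin n → ℝ) → F} (hf : ContDiff ℝ (⊤ : ℕ∞) f) (i : Fin n) :
    ContDiff ℝ (⊤ : ℕ∞) (pderivI i f) :=
  (hf.fderiv_right (m := (⊤ : ℕ∞)) le_rfl).clm_apply contDiff_const

lemma ContDiff.pderivWord {f : (Fin n → ℝ) → F} (hf : ContDiff ℝ (⊤ : ℕ∞) f)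
    (L : List (Fin n)) : ContDiff ℝ (⊤ : ℕ∞) (pderivWord L f) := by
  induction L with
  | nil => exact hf
  | cons i L ih => exact ih.pderivI i

lemma ContDiff.diffOp [FiniteDimensional ℝ F] {f : (Fin n → ℝ) → F}
    (hf : ContDiff ℝ (⊤ : ℕ∞) f) (k : ℕ) (coef : (Fin n → ℕ) → (F →ₗ[ℝ] G)) :
    ContDiff ℝ (⊤ : ℕ∞) (diffOp k coef f) := by
  have : _root_.diffOp k coef f = fun x => _ := funext (diffOp_eq_sum_pderivWord k coef f)
  rw [this]
  exact ContDiff.sum fun α _ => (coef α).toContinuousLinearMap.contDiff.comp (hf.pderivWord _)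

lemma pderivWord_congr_nhds {f g : (Fin n → ℝ) → F} {x : Fin n → ℝ} (h : f =ᶠ[nhds x] g)
    (L : List (Fin n)) : pderivWord L f =ᶠ[nhds x] pderivWord L g := by
  induction L with
  | nil => exact h
  | cons i L ih =>
    filter_upwards [ih.eventuallyEq_nhds] with y hy
    simp only [pderivWord_cons, pderivI, hy.fderiv_eq]

lemma diffOp_congr_nhds {f g : (Fin n → ℝ) → F} {x : Fin n → ℝ} (h : f =ᶠ[nhds x] g)
    (k : ℕ) (coef : (Fin n → ℕ) → (F →ₗ[ℝ] G)) : diffOp k coef f x = diffOp k coef g x := by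
  simp only [diffOp_eq_sum_pderivWord, (pderivWord_congr_nhds h _).eq_of_nhds]

lemma pderivWord_comp_add {f : (Fin n → ℝ) → F} {z : Fin n → ℝ} (h : ∀ x, f (x + z) = f x)
    (L : List (Fin n)) (x : Fin n → ℝ) : pderivWord L f (x + z) = pderivWord L f x := by
  induction L generalizing x with
  | nil => exact h x
  | cons i L ih =>
    simp only [pderivWord_cons, pderivI]
    rw [← fderiv_comp_add_right, funext ih]

lemma diffOp_comp_add {f : (Fin n → ℝ) → F} {z : Fin n → ℝ} (h : ∀ x, f (x + z) = f x)
    (k : ℕ) (coef : (Fin n → ℕ) → (F →ₗ[ℝ] G)) (x : Fin n → ℝ) :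
    diffOp k coef f (x + z) = diffOp k coef f x := by
  simp only [diffOp_eq_sum_pderivWord, pderivWord_comp_add h]

lemma pderivWord_add {f g : (Fin n → ℝ) → F} (hf : ContDiff ℝ (⊤ : ℕ∞) f)
    (hg : ContDiff ℝ (⊤ : ℕ∞) g) (L : List (Fin n)) (x : Fin n → ℝ) :
    pderivWord L (fun y => f y + g y) x = pderivWord L f x + pderivWord L g x := by
  induction L generalizing x with
  | nil => rfl
  | cons i L ih =>
    simp only [pderivWord_cons, pderivI]
    rw [funext ih, fderiv_fun_add ((hf.pderivWord L).differentiable (by simp) x)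
      ((hg.pderivWord L).differentiable (by simp) x)]
    rfl

lemma diffOp_add {f g : (Fin n → ℝ) → F} (hf : ContDiff ℝ (⊤ : ℕ∞) f)
    (hg : ContDiff ℝ (⊤ : ℕ∞) g) (k : ℕ) (coef : (Fin n → ℕ) → (F →ₗ[ℝ] G)) (x : Fin n → ℝ) :
    diffOp k coef (fun y => f y + g y) x = diffOp k coef f x + diffOp k coef g x := by
  simp only [diffOp_eq_sum_pderivWord, pderivWord_add hf hg, map_add, Finset.sum_add_distrib]

lemma pderivWord_rescale {f : (Fin n → ℝ) → F} (hf : ContDiff ℝ (⊤ : ℕ∞) f) (r t : ℝ)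
    (L : List (Fin n)) (x : Fin n → ℝ) :
    pderivWord L (fun y => r • f (t • y)) x = (r * t ^ L.length) • pderivWord L f (t • x) := by
  induction L generalizing x with
  | nil => simp [pderivWord_nil]
  | cons i L ih =>
    simp only [pderivWord_cons, pderivI]
    have hd := (hf.pderivWord L).differentiable (by simp) (t • x)
    have h1 : HasFDerivAt (fun y : Fin n → ℝ => t • y)
        (t • ContinuousLinearMap.id ℝ (Fin n → ℝ)) x := (hasFDerivAt_id x).const_smul t
    have h2 := (hd.hasFDerivAt.comp x h1).const_smul (r * t ^ L.length)
    rw [funext ih]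
    erw [h2.fderiv]
    simp [smul_smul, pow_succ, mul_assoc]

lemma diffOp_rescale {f : (Fin n → ℝ) → F} (hf : ContDiff ℝ (⊤ : ℕ∞) f) (r t : ℝ)
    (k : ℕ) (coef : (Fin n → ℕ) → (F →ₗ[ℝ] G)) (x : Fin n → ℝ) :
    diffOp k coef (fun y => r • f (t • y)) x = (r * t ^ k) • diffOp k coef f (t • x) := by
  simp only [diffOp_eq_sum_pderivWord, pderivWord_rescale hf, Finset.smul_sum]
  refine Finset.sum_congr rfl fun α hα => ?_
  rw [length_wordOf_of_mem hα, map_smul]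

end Words

/-- A family of smooth functions whose derivatives of every order are uniformly bounded. -/
def UniformlySmooth {ι E F : Type*} [NormedAddCommGroup E] [NormedSpace ℝ E]
    [NormedAddCommGroup F] [NormedSpace ℝ F] (g : ι → E → F) : Prop :=
  (∀ i, ContDiff ℝ (⊤ : ℕ∞) (g i)) ∧
    ∀ j : ℕ, ∃ C : ℝ, 0 ≤ C ∧ ∀ i x, ‖iteratedFDeriv ℝ j (g i) x‖ ≤ C

namespace UniformlySmooth

variable {ι E E' F : Type*} [NormedAddCommGroup E] [NormedSpace ℝ E]
  [NormedAddCommGroup E'] [NormedSpace ℝ E'] [NormedAddCommGroup F] [NormedSpace ℝ F]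

lemma exists_norm_le {g : ι → E → F} (hg : UniformlySmooth g) :
    ∃ C, ∀ i x, ‖g i x‖ ≤ C := by
  obtain ⟨C, -, hC⟩ := hg.2 0
  exact ⟨C, fun i x => by simpa using hC i x⟩

lemma smul {g : ι → E → ℝ} {h : ι → E → F} (hg : UniformlySmooth g) (hh : UniformlySmooth h) :
    UniformlySmooth fun i x => g i x • h i x := by
  refine ⟨fun i => (hg.1 i).smul (hh.1 i), fun j => ?_⟩
  choose A hA0 hA using hg.2
  choose B hB0 hB using hh.2
  refine ⟨∑ m ∈ Finset.range (j + 1), (j.choose m : ℝ) * A m * B (j - m),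
    Finset.sum_nonneg fun m _ => by have := hA0 m; have := hB0 (j - m); positivity,
    fun i x => (norm_iteratedFDeriv_smul_le (hg.1 i) (hh.1 i) x
      (by exact_mod_cast le_top)).trans ?_⟩
  gcongr with m
  · have := hA0 m; positivity
  · exact hA m i x
  · exact hB _ i x

lemma comp_clm {g : ι → E → F} (hg : UniformlySmooth g) (L : E' →L[ℝ] E) :
    UniformlySmooth fun i x => g i (L x) := by
  refine ⟨fun i => (hg.1 i).comp L.contDiff, fun j => ?_⟩
  obtain ⟨C, hC0, hC⟩ := hg.2 j
  refine ⟨C * ‖L‖ ^ j, by positivity, fun i x => ?_⟩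
  have := L.iteratedFDeriv_comp_right (hg.1 i) x (i := j) (by exact_mod_cast le_top)
  change ‖iteratedFDeriv ℝ j (g i ∘ L) x‖ ≤ _
  rw [this]
  refine (ContinuousMultilinearMap.norm_compContinuousLinearMap_le _ _).trans ?_
  simp only [Finset.prod_const, Finset.card_univ, Fintype.card_fin]
  gcongr
  exact hC i _

lemma comp_add {g : ι → E → F} (hg : UniformlySmooth g) (z : ι → E) :
    UniformlySmooth fun i x => g i (x + z i) := by
  refine ⟨fun i => (hg.1 i).comp (contDiff_id.add contDiff_const), fun j => ?_⟩
  obtain ⟨C, hC0, hC⟩ := hg.2 j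
  exact ⟨C, hC0, fun i x => by rw [iteratedFDeriv_comp_add_right]; exact hC i _⟩

lemma reindex {κ : Type*} {g : ι → E → F} (hg : UniformlySmooth g) (e : κ → ι) :
    UniformlySmooth fun i => g (e i) :=
  ⟨fun _ => hg.1 _, fun j => let ⟨C, hC0, hC⟩ := hg.2 j; ⟨C, hC0, fun _ => hC _⟩⟩

lemma prod {κ : Type*} {g : κ → ι → E → ℝ} (hg : ∀ k, UniformlySmooth (g k)) (s : Finset κ) :
    UniformlySmooth fun i x => ∏ k ∈ s, g k i x := by
  classical
  induction s using Finset.induction_on with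
  | empty =>
    refine ⟨fun i => by simpa using contDiff_const, fun j => ⟨1, zero_le_one, fun i x => ?_⟩⟩
    simp only [Finset.prod_empty]
    rcases j with _ | j
    · simp
    · simp [iteratedFDeriv_const_of_ne (Nat.succ_ne_zero j)]
  | insert k s hk ih =>
    simp only [Finset.prod_insert hk]
    exact (hg k).smul ih

lemma pderivI {n : ℕ} {g : ι → (Fin n → ℝ) → F} (hg : UniformlySmooth g) (i : Fin n) :
    UniformlySmooth fun k => pderivI i (g k) := by
  refine ⟨fun k => (hg.1 k).pderivI i, fun j => ?_⟩
  obtain ⟨C, hC0, hC⟩ := hg.2 (j + 1)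
  refine ⟨C, hC0, fun k x => ?_⟩
  have h1 := norm_iteratedFDeriv_clm_apply_const (c := (Pi.single i 1 : Fin n → ℝ))
    (((hg.1 k).fderiv_right (m := (⊤ : ℕ∞)) le_rfl).contDiffAt (x := x)) (n := j)
    (by exact_mod_cast le_top)
  refine h1.trans ?_
  rw [norm_iteratedFDeriv_fderiv, Pi.norm_single, norm_one, one_mul]
  exact hC k x

lemma pderivWord {n : ℕ} {g : ι → (Fin n → ℝ) → F} (hg : UniformlySmooth g) (L : List (Fin n)) :
    UniformlySmooth fun k => pderivWord L (g k) := by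
  induction L with
  | nil => exact hg
  | cons i L ih => exact ih.pderivI i

lemma exists_norm_diffOp_le {n : ℕ} {G : Type*} [NormedAddCommGroup G] [NormedSpace ℝ G]
    [FiniteDimensional ℝ F] {g : ι → (Fin n → ℝ) → F} (hg : UniformlySmooth g)
    (k : ℕ) (coef : (Fin n → ℕ) → (F →ₗ[ℝ] G)) :
    ∃ C, ∀ i x, ‖diffOp k coef (g i) x‖ ≤ C := by
  choose C hC using fun α : Fin n → ℕ => (hg.pderivWord (wordOf α)).exists_norm_le
  refine ⟨∑ α ∈ Finset.Nat.antidiagonalTuple n k, ‖(coef α).toContinuousLinearMap‖ * C α,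
    fun i x => ?_⟩
  rw [diffOp_eq_sum_pderivWord]
  refine norm_sum_le_of_le _ fun α _ => ?_
  exact ((coef α).toContinuousLinearMap.le_opNorm _).trans (by gcongr; exact hC α i x)

end UniformlySmooth

/-- Invariance under translations by integer vectors. -/
def ZPeriodic {n : ℕ} {F : Type*} (g : (Fin n → ℝ) → F) : Prop :=
  ∀ (x : Fin n → ℝ) (z : Fin n → ℤ), g (x + fun i => (z i : ℝ)) = g x

/-- The projection of `ℝⁿ` onto the unit torus. -/
def toTorus {n : ℕ} (x : Fin n → ℝ) : Fin n → UnitAddCircle := fun i => (x i : UnitAddCircle)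

section Periodic

variable {n : ℕ} {F G : Type*} [NormedAddCommGroup F] [NormedSpace ℝ F]
  [NormedAddCommGroup G] [NormedSpace ℝ G]

lemma isOpenQuotientMap_toTorus : IsOpenQuotientMap (toTorus (n := n)) :=
  IsOpenQuotientMap.piMap fun _ => QuotientAddGroup.isOpenQuotientMap_mk

lemma ZPeriodic.exists_torus_lift {F : Type*} [TopologicalSpace F] {g : (Fin n → ℝ) → F}
    (hg : ZPeriodic g) (hc : Continuous g) :
    ∃ g' : (Fin n → UnitAddCircle) → F, Continuous g' ∧ ∀ x, g' (toTorus x) = g x := by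
  have hf : Function.FactorsThrough g (toTorus (n := n)) := by
    intro x y hxy
    have h : ∀ i, ∃ m : ℤ, x i = y i + m := fun i => by
      have hi : ((x i : ℝ) : UnitAddCircle) = (y i : ℝ) := congrFun hxy i
      obtain ⟨m, hm⟩ := (QuotientAddGroup.eq_iff_sub_mem.1 hi)
      exact ⟨m, by simp at hm; linarith⟩
    choose z hz using h
    rw [← hg y z]
    congr 1
    exact funext hz
  let q : C(Fin n → ℝ, Fin n → UnitAddCircle) :=
    ⟨toTorus, isOpenQuotientMap_toTorus.continuous⟩
  have hq : Topology.IsQuotientMap q := isOpenQuotientMap_toTorus.isQuotientMap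
  refine ⟨hq.lift ⟨g, hc⟩ hf, (hq.lift ⟨g, hc⟩ hf).continuous, fun x => ?_⟩
  exact congrArg (fun h : C(Fin n → ℝ, F) => h x) (hq.lift_comp ⟨g, hc⟩ hf)

lemma measurePreserving_toTorus :
    MeasurePreserving (toTorus (n := n)) (volume.restrict (Set.Icc 0 1)) volume := by
  have h := measurePreserving_pi
    (fun _ : Fin n => (volume : Measure ℝ).restrict (Set.Ioc 0 (0 + 1)))
    (fun _ => (volume : Measure UnitAddCircle))
    (fun _ => UnitAddCircle.measurePreserving_mk 0)
  rw [← Measure.restrict_pi_pi] at h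
  have h2 := Measure.univ_pi_Ioc_ae_eq_Icc (μ := fun _ : Fin n => (volume : Measure ℝ))
    (f := (0 : Fin n → ℝ)) (g := 1)
  have h3 : (Measure.pi fun _ : Fin n => (volume : Measure ℝ)).restrict
      (Set.univ.pi fun _ => Set.Ioc 0 (0 + 1)) = volume.restrict (Set.Icc 0 1) := by
    rw [zero_add]
    exact Measure.restrict_congr_set h2
  rw [h3] at h
  exact h

lemma setIntegral_comp_toTorus {g : (Fin n → UnitAddCircle) → F}
    (hg : AEStronglyMeasurable g volume) :
    ∫ x in Set.Icc (0 : Fin n → ℝ) 1, g (toTorus x) = ∫ t, g t := by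
  have h := measurePreserving_toTorus (n := n)
  rw [← h.map_eq, integral_map h.measurable.aemeasurable (by rwa [h.map_eq])]

lemma ZPeriodic.setIntegral_comp_add {g : (Fin n → ℝ) → F} (hg : ZPeriodic g) (hc : Continuous g)
    (t : Fin n → ℝ) :
    ∫ x in Set.Icc (0 : Fin n → ℝ) 1, g (x + t) = ∫ x in Set.Icc (0 : Fin n → ℝ) 1, g x := by
  obtain ⟨g', hc', hg'⟩ := hg.exists_torus_lift hc
  have h1 : ∀ x, g (x + t) = g' (toTorus x + toTorus t) := fun x => (hg' (x + t)).symm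
  simp only [h1, ← hg']
  rw [setIntegral_comp_toTorus (g := fun s => g' (s + toTorus t))
      (hc'.comp (continuous_id.add continuous_const)).aestronglyMeasurable,
    setIntegral_comp_toTorus hc'.aestronglyMeasurable, integral_add_right_eq_self g']

lemma setIntegral_comp_toTorus_nsmul {g : (Fin n → UnitAddCircle) → F}
    (hg : AEStronglyMeasurable g volume) {N : ℕ} (hN : N ≠ 0) :
    ∫ x in Set.Icc (0 : Fin n → ℝ) 1, g (toTorus ((N : ℝ) • x)) = ∫ t, g t := by
  have h : MeasurePreserving (fun (t : Fin n → UnitAddCircle) i => (N : ℤ) • t i)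
      volume volume := measurePreserving_pi (fun _ : Fin n => (volume : Measure UnitAddCircle))
    (fun _ => (volume : Measure UnitAddCircle))
    (fun _ => Measure.measurePreserving_zsmul (volume : Measure UnitAddCircle)
      (Int.natCast_ne_zero.2 hN))
  have h1 : ∀ x : Fin n → ℝ, toTorus ((N : ℝ) • x) = fun i => (N : ℤ) • toTorus x i := by
    intro x; funext i
    simp [toTorus, ← nsmul_eq_mul]
  simp only [h1]
  have hg2 : AEStronglyMeasurable (fun t : Fin n → UnitAddCircle => g fun i => (N : ℤ) • t i)
      volume := hg.comp_measurePreserving h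
  rw [setIntegral_comp_toTorus hg2]
  conv_rhs => rw [← h.map_eq]
  rw [integral_map h.measurable.aemeasurable (by rw [h.map_eq]; exact hg)]

lemma ZPeriodic.exists_mem_Icc {F : Type*} {g : (Fin n → ℝ) → F} (hg : ZPeriodic g)
    (x : Fin n → ℝ) : ∃ y ∈ Set.Icc (0 : Fin n → ℝ) 1, g y = g x := by
  refine ⟨fun i => Int.fract (x i), ⟨fun i => Int.fract_nonneg _,
    fun i => (Int.fract_lt_one _).le⟩, ?_⟩
  rw [← hg _ fun i => ⌊x i⌋]
  congr 1
  funext i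
  simp

lemma ZPeriodic.exists_norm_le {F : Type*} [NormedAddCommGroup F] {g : (Fin n → ℝ) → F}
    (hg : ZPeriodic g) (hc : Continuous g) :
    ∃ C, 0 ≤ C ∧ ∀ x, ‖g x‖ ≤ C := by
  obtain ⟨C, hC⟩ := (isCompact_Icc (a := (0 : Fin n → ℝ)) (b := 1)).exists_bound_of_continuousOn
    hc.continuousOn
  refine ⟨max C 0, le_max_right _ _, fun x => ?_⟩
  obtain ⟨y, hy, hyx⟩ := hg.exists_mem_Icc x
  exact hyx ▸ (hC y hy).trans (le_max_left _ _)

lemma ZPeriodic.uniformlySmooth {g : (Fin n → ℝ) → F} (hg : ZPeriodic g)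
    (hc : ContDiff ℝ (⊤ : ℕ∞) g) : UniformlySmooth fun _ : Unit => g := by
  refine ⟨fun _ => hc, fun j => ?_⟩
  have hp : ZPeriodic (iteratedFDeriv ℝ j g) := fun x z => by
    rw [← iteratedFDeriv_comp_add_right]
    congr 1
    exact funext fun y => hg y z
  obtain ⟨C, hC0, hC⟩ := hp.exists_norm_le (hc.continuous_iteratedFDeriv
    (m := j) (by exact_mod_cast le_top))
  exact ⟨C, hC0, fun _ => hC⟩

lemma ZPeriodic.pderivWord {g : (Fin n → ℝ) → F} (hg : ZPeriodic g) (L : List (Fin n)) :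
    ZPeriodic (pderivWord L g) :=
  fun x z => pderivWord_comp_add (fun y => hg y z) L x

lemma ZPeriodic.diffOp {g : (Fin n → ℝ) → F} (hg : ZPeriodic g) (k : ℕ)
    (coef : (Fin n → ℕ) → (F →ₗ[ℝ] G)) : ZPeriodic (diffOp k coef g) :=
  fun x z => diffOp_comp_add (fun y => hg y z) k coef x

lemma ZPeriodic.integral_pderivI {g : (Fin n → ℝ) → F} (hg : ZPeriodic g)
    (hc : ContDiff ℝ (⊤ : ℕ∞) g) (i : Fin n) :
    ∫ x in Set.Icc (0 : Fin n → ℝ) 1, pderivI i g x = 0 := by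
  let e : Fin n → ℝ := Pi.single i 1
  have hp : ZPeriodic (pderivI i g) := hg.pderivWord [i]
  obtain ⟨C, -, hC⟩ := hp.exists_norm_le (hc.pderivI i).continuous
  have hder : ∀ x : Fin n → ℝ, ∀ t : ℝ,
      HasDerivAt (fun t : ℝ => g (x + t • e)) (pderivI i g (x + t • e)) t := by
    intro x t
    have h1 : HasDerivAt (fun t : ℝ => x + t • e) e t := by
      simpa using ((hasDerivAt_id t).smul_const e).const_add x
    exact ((hc.differentiable (by simp) (x + t • e)).hasFDerivAt).comp_hasDerivAt t h1
  have hmain := hasDerivAt_integral_of_dominated_loc_of_deriv_le (𝕜 := ℝ)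
    (μ := volume.restrict (Set.Icc (0 : Fin n → ℝ) 1))
    (F := fun (t : ℝ) x => g (x + t • e)) (F' := fun (t : ℝ) x => pderivI i g (x + t • e))
    (x₀ := 0) (s := Set.univ) (bound := fun _ => C) Filter.univ_mem
    (Filter.Eventually.of_forall fun t =>
      (hc.continuous.comp (continuous_id.add continuous_const)).aestronglyMeasurable)
    (by
      simp only [zero_smul, add_zero]
      exact hc.continuous.continuousOn.integrableOn_compact isCompact_Icc)
    (by simpa using (hc.pderivI i).continuous.aestronglyMeasurable)
    (Filter.Eventually.of_forall fun x t _ => hC _)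
    (integrableOn_const (isCompact_Icc.measure_lt_top.ne))
    (Filter.Eventually.of_forall fun x t _ => hder x t)
  have h2 := hmain.2
  simp only [hg.setIntegral_comp_add hc.continuous, zero_smul, add_zero] at h2
  exact h2.unique (hasDerivAt_const _ _)

end Periodic

/-- The phase `x ↦ 2π ξ · x`. -/
noncomputable def phase {n : ℕ} (ξ : Fin n → ℤ) : (Fin n → ℝ) →L[ℝ] ℝ :=
  ∑ i, (2 * Real.pi * ξ i) • ContinuousLinearMap.proj i

/-- The real Fourier coefficient `∫ cos (2π ξ · x + φ) g(x) dx` over the unit cube. -/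
noncomputable def trigCoeff {n : ℕ} {F : Type*} [NormedAddCommGroup F] [NormedSpace ℝ F]
    (ξ : Fin n → ℤ) (φ : ℝ) (g : (Fin n → ℝ) → F) : F :=
  ∫ x in Set.Icc (0 : Fin n → ℝ) 1, Real.cos (phase ξ x + φ) • g x

section TrigCoeff

variable {n : ℕ} {F G : Type*} [NormedAddCommGroup F] [NormedSpace ℝ F]
  [NormedAddCommGroup G] [NormedSpace ℝ G]

lemma phase_apply (ξ : Fin n → ℤ) (x : Fin n → ℝ) :
    phase ξ x = ∑ i, 2 * Real.pi * ξ i * x i := by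
  simp [phase]

lemma phase_single (ξ : Fin n → ℤ) (i : Fin n) :
    phase ξ (Pi.single i 1) = 2 * Real.pi * ξ i := by
  simp [phase_apply, Pi.single_apply]

lemma zperiodic_cos_phase (ξ : Fin n → ℤ) (φ : ℝ) :
    ZPeriodic fun x : Fin n → ℝ => Real.cos (phase ξ x + φ) := by
  intro x z
  have : phase ξ (fun i => (z i : ℝ)) = (∑ i, ξ i * z i : ℤ) * (2 * Real.pi) := by
    rw [phase_apply]; push_cast; rw [Finset.sum_mul]
    exact Finset.sum_congr rfl fun i _ => by ring
  simp only [map_add]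
  rw [this, add_right_comm, Real.cos_add_int_mul_two_pi]

lemma contDiff_cos_phase (ξ : Fin n → ℤ) (φ : ℝ) :
    ContDiff ℝ (⊤ : ℕ∞) fun x : Fin n → ℝ => Real.cos (phase ξ x + φ) :=
  Real.contDiff_cos.comp ((phase ξ).contDiff.add contDiff_const)

lemma hasFDerivAt_cos_phase (ξ : Fin n → ℤ) (φ : ℝ) (x : Fin n → ℝ) :
    HasFDerivAt (fun x : Fin n → ℝ => Real.cos (phase ξ x + φ))
      (Real.cos (phase ξ x + φ + Real.pi / 2) • phase ξ) x := by
  rw [Real.cos_add_pi_div_two]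
  exact ((phase ξ).hasFDerivAt.add_const φ).cos

lemma integrableOn_cos_phase_smul {g : (Fin n → ℝ) → F} (hc : Continuous g) (ξ : Fin n → ℤ)
    (φ : ℝ) : IntegrableOn (fun x => Real.cos (phase ξ x + φ) • g x) (Set.Icc 0 1) :=
  ((contDiff_cos_phase ξ φ).continuous.smul hc).continuousOn.integrableOn_compact isCompact_Icc

lemma trigCoeff_pderivI {g : (Fin n → ℝ) → F} (hg : ZPeriodic g) (hc : ContDiff ℝ (⊤ : ℕ∞) g)
    (ξ : Fin n → ℤ) (φ : ℝ) (i : Fin n) :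
    trigCoeff ξ φ (pderivI i g)
      = (-(2 * Real.pi) * ξ i) • trigCoeff ξ (φ + Real.pi / 2) g := by
  have hper : ZPeriodic fun x => Real.cos (phase ξ x + φ) • g x := fun x z => by
    have h1 := zperiodic_cos_phase ξ φ x z
    simp only at h1 ⊢
    rw [h1, hg x z]
  have h0 := hper.integral_pderivI ((contDiff_cos_phase ξ φ).smul hc) i
  have h1 : ∀ x, pderivI i (fun x => Real.cos (phase ξ x + φ) • g x) x
      = Real.cos (phase ξ x + φ) • pderivI i g x
        + (2 * Real.pi * ξ i) • Real.cos (phase ξ x + (φ + Real.pi / 2)) • g x := by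
    intro x
    have := (hasFDerivAt_cos_phase ξ φ x).fun_smul
      (hc.differentiable (by simp) x).hasFDerivAt
    simp only [pderivI, this.fderiv]
    simp [phase_single, smul_smul, add_assoc, mul_comm]
  simp only [h1] at h0
  have h2 := (integrableOn_cos_phase_smul hc.continuous ξ (φ + Real.pi / 2)).fun_smul
    (2 * Real.pi * (ξ i : ℝ))
  rw [integral_add (integrableOn_cos_phase_smul (hc.pderivI i).continuous ξ φ) h2,
    integral_smul] at h0
  rw [neg_mul, neg_smul]
  exact eq_neg_of_add_eq_zero_left h0

lemma trigCoeff_pderivWord {g : (Fin n → ℝ) → F} (hg : ZPeriodic g)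
    (hc : ContDiff ℝ (⊤ : ℕ∞) g) (ξ : Fin n → ℤ) (φ : ℝ) (L : List (Fin n)) :
    trigCoeff ξ φ (pderivWord L g)
      = ((-(2 * Real.pi)) ^ L.length * (L.map fun i => (ξ i : ℝ)).prod) •
        trigCoeff ξ (φ + L.length * (Real.pi / 2)) g := by
  induction L generalizing φ with
  | nil => simp [pderivWord_nil]
  | cons i L ih =>
    rw [pderivWord_cons, trigCoeff_pderivI (hg.pderivWord L) (hc.pderivWord L), ih, smul_smul,
      List.map_cons, List.prod_cons, List.length_cons]
    congr 1
    · ring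
    · congr 1; push_cast; ring

lemma trigCoeff_clm_comp [CompleteSpace F] [CompleteSpace G] {g : (Fin n → ℝ) → F}
    (hc : Continuous g) (T : F →L[ℝ] G) (ξ : Fin n → ℤ) (φ : ℝ) :
    trigCoeff ξ φ (fun x => T (g x)) = T (trigCoeff ξ φ g) := by
  unfold trigCoeff
  rw [← T.integral_comp_comm (integrableOn_cos_phase_smul hc ξ φ)]
  simp

lemma trigCoeff_diffOp [FiniteDimensional ℝ F] [FiniteDimensional ℝ G] {g : (Fin n → ℝ) → F}
    (hg : ZPeriodic g) (hc : ContDiff ℝ (⊤ : ℕ∞) g) (k : ℕ)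
    (coef : (Fin n → ℕ) → (F →ₗ[ℝ] G)) (ξ : Fin n → ℤ) (φ : ℝ) :
    trigCoeff ξ φ (diffOp k coef g) = (-(2 * Real.pi)) ^ k •
      symbolOf k coef (fun i => (ξ i : ℝ)) (trigCoeff ξ (φ + k * (Real.pi / 2)) g) := by
  have := FiniteDimensional.complete ℝ F
  have := FiniteDimensional.complete ℝ G
  have h1 : ∀ x, Real.cos (phase ξ x + φ) • diffOp k coef g x
      = ∑ α ∈ Finset.Nat.antidiagonalTuple n k,
        Real.cos (phase ξ x + φ) • (coef α).toContinuousLinearMap (pderivWord (wordOf α) g x) :=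
    fun x => by rw [diffOp_eq_sum_pderivWord, Finset.smul_sum]; rfl
  have h2 : trigCoeff ξ φ (diffOp k coef g) = ∑ α ∈ Finset.Nat.antidiagonalTuple n k,
      trigCoeff ξ φ fun x => (coef α).toContinuousLinearMap (pderivWord (wordOf α) g x) := by
    unfold trigCoeff
    simp only [h1]
    exact integral_finsetSum _ fun α _ => integrableOn_cos_phase_smul
      ((coef α).toContinuousLinearMap.continuous.comp (hc.pderivWord _).continuous) ξ φ
  rw [h2, symbolOf, LinearMap.sum_apply, Finset.smul_sum]
  refine Finset.sum_congr rfl fun α hα => ?_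
  rw [trigCoeff_clm_comp (hc.pderivWord _).continuous, trigCoeff_pderivWord hg hc,
    length_wordOf_of_mem hα, prod_map_wordOf]
  simp [smul_smul]

end TrigCoeff

/-- Decay of a family indexed by `ℤⁿ` faster than every power of the index. -/
def RapidDecay {n : ℕ} {F : Type*} [NormedAddCommGroup F] (c : (Fin n → ℤ) → F) : Prop :=
  ∀ m : ℕ, Summable fun ξ => (1 + ‖ξ‖) ^ m * ‖c ξ‖

/-- The trigonometric series `∑ cos (2π ξ · x + φ) c_ξ`. -/
noncomputable def trigSeries {n : ℕ} {F : Type*} [NormedAddCommGroup F] [NormedSpace ℝ F]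
    (φ : ℝ) (c : (Fin n → ℤ) → F) (x : Fin n → ℝ) : F :=
  ∑' ξ, Real.cos (phase ξ x + φ) • c ξ

section Decay

variable {n : ℕ} {F G : Type*} [NormedAddCommGroup F] [NormedSpace ℝ F]
  [NormedAddCommGroup G] [NormedSpace ℝ G]

lemma summable_prod_apply {h : ℤ → ℝ} (h0 : ∀ a, 0 ≤ h a) (hs : Summable h) (n : ℕ) :
    Summable fun ξ : Fin n → ℤ => ∏ i, h (ξ i) := by
  induction n with
  | zero => exact (hasSum_fintype _).summable
  | succ n ih =>
    rw [← (Fin.consEquiv fun _ : Fin (n + 1) => ℤ).summable_iff]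
    refine (hs.mul_of_nonneg ih h0 fun ξ => Finset.prod_nonneg fun i _ => h0 _).congr fun p => ?_
    simp [Fin.prod_univ_succ, Fin.consEquiv]

lemma summable_inv_one_add_norm_pow (n : ℕ) :
    Summable fun ξ : Fin n → ℤ => ((1 + ‖ξ‖) ^ (2 * n))⁻¹ := by
  have h1 : Summable fun a : ℤ => ((1 + |(a : ℝ)|) ^ 2)⁻¹ := by
    have h2 : Summable fun a : ℤ => 1 / (a : ℝ) ^ 2 :=
      Real.summable_one_div_int_pow.2 (by norm_num)
    refine h2.of_norm_bounded_eventually ?_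
    have : {(0 : ℤ)}ᶜ ∈ Filter.cofinite := (Set.finite_singleton (0 : ℤ)).compl_mem_cofinite
    filter_upwards [this] with a ha
    have ha0 : (0 : ℝ) < |(a : ℝ)| := by simpa using ha
    rw [Real.norm_of_nonneg (by positivity), one_div, ← sq_abs (a : ℝ)]
    gcongr
    linarith
  refine (summable_prod_apply (fun a => by positivity) h1 n).of_nonneg_of_le
    (fun ξ => by positivity) fun ξ => ?_
  rw [Finset.prod_inv_distrib]
  refine inv_anti₀ (Finset.prod_pos fun i _ => by positivity) ?_
  rw [pow_mul]
  calc ∏ i, (1 + |(ξ i : ℝ)|) ^ 2 ≤ ∏ _i : Fin n, (1 + ‖ξ‖) ^ 2 := by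
        gcongr with i
        have := norm_le_pi_norm ξ i
        rwa [Int.norm_eq_abs] at this
    _ = _ := by simp

lemma rapidDecay_of_bounds {F : Type*} [NormedAddCommGroup F] {c : (Fin n → ℤ) → F}
    (h : ∀ m : ℕ, ∃ C, ∀ ξ, (1 + ‖ξ‖) ^ m * ‖c ξ‖ ≤ C) : RapidDecay c := by
  intro m
  obtain ⟨C, hC⟩ := h (m + 2 * n)
  refine ((summable_inv_one_add_norm_pow n).mul_left C).of_nonneg_of_le
    (fun ξ => by positivity) fun ξ => ?_
  rw [← div_eq_mul_inv, le_div_iff₀ (by positivity)]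
  exact le_trans (le_of_eq (by rw [pow_add]; ring)) (hC ξ)

lemma RapidDecay.mono {F G : Type*} [NormedAddCommGroup F] [NormedAddCommGroup G]
    {c : (Fin n → ℤ) → F} (hc : RapidDecay c) {d : (Fin n → ℤ) → G} (C : ℝ) (k : ℕ)
    (h : ∀ ξ, ‖d ξ‖ ≤ C * (1 + ‖ξ‖) ^ k * ‖c ξ‖) : RapidDecay d := by
  intro m
  refine ((hc (m + k)).mul_left C).of_nonneg_of_le (fun ξ => by positivity) fun ξ => ?_
  calc (1 + ‖ξ‖) ^ m * ‖d ξ‖ ≤ (1 + ‖ξ‖) ^ m * (C * (1 + ‖ξ‖) ^ k * ‖c ξ‖) := by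
        gcongr; exact h ξ
    _ = _ := by rw [pow_add]; ring

lemma norm_trigCoeff_le {g : (Fin n → ℝ) → F} {C : ℝ} (hC : ∀ x, ‖g x‖ ≤ C) (ξ : Fin n → ℤ)
    (φ : ℝ) : ‖trigCoeff ξ φ g‖ ≤ C := by
  have hvol : (volume : Measure (Fin n → ℝ)).real (Set.Icc 0 1) = 1 := by
    simp [Measure.real, Real.volume_Icc_pi]
  have h := norm_setIntegral_le_of_norm_le_const (μ := (volume : Measure (Fin n → ℝ)))
    (s := Set.Icc 0 1) (f := fun x => Real.cos (phase ξ x + φ) • g x) (C := C)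
    (isCompact_Icc.measure_lt_top) fun x _ => by
      rw [norm_smul]
      exact (mul_le_of_le_one_left (norm_nonneg _) (Real.abs_cos_le_one _)).trans (hC x)
  rwa [hvol, mul_one] at h

lemma ZPeriodic.rapidDecay_trigCoeff {g : (Fin n → ℝ) → F} (hg : ZPeriodic g)
    (hc : ContDiff ℝ (⊤ : ℕ∞) g) (φ : ℝ) : RapidDecay fun ξ => trigCoeff ξ φ g := by
  refine rapidDecay_of_bounds fun m => ?_
  choose C hC0 hC using fun i : Fin n =>
    (hg.pderivWord (List.replicate m i)).exists_norm_le (hc.pderivWord _).continuous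
  obtain ⟨D, hD0, hD⟩ := hg.exists_norm_le hc.continuous
  have hS : 0 ≤ ∑ i, C i := Finset.sum_nonneg fun i _ => hC0 i
  refine ⟨D + ∑ i, C i, fun ξ => ?_⟩
  rcases eq_or_ne ξ 0 with rfl | hξ
  · have := norm_trigCoeff_le hD (0 : Fin n → ℤ) φ
    simp only [norm_zero, add_zero, one_pow, one_mul]
    linarith
  · have hne : Nonempty (Fin n) := by
      by_contra h
      rw [not_nonempty_iff] at h
      exact hξ (Subsingleton.elim _ _)
    obtain ⟨i, -, hi⟩ := Finset.exists_max_image Finset.univ (fun i => ‖ξ i‖)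
      Finset.univ_nonempty
    have hnorm : ‖ξ‖ ≤ |(ξ i : ℝ)| := by
      rw [← Int.norm_eq_abs]
      exact (pi_norm_le_iff_of_nonneg (norm_nonneg _)).2 fun j => hi j (Finset.mem_univ _)
    have hone : 1 ≤ |(ξ i : ℝ)| := by
      have : ξ i ≠ 0 := fun h => by
        apply hξ
        have h0 : ‖ξ‖ ≤ 0 := by simpa [h] using hnorm
        exact norm_le_zero_iff.1 h0
      exact_mod_cast Int.one_le_abs this
    have hle : 1 + ‖ξ‖ ≤ 2 * Real.pi * |(ξ i : ℝ)| := by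
      nlinarith [Real.pi_gt_three]
    have h1 := trigCoeff_pderivWord hg hc ξ (φ - m * (Real.pi / 2)) (List.replicate m i)
    rw [List.length_replicate, sub_add_cancel, List.map_replicate, List.prod_replicate] at h1
    have h2 := norm_trigCoeff_le (hC i) ξ (φ - m * (Real.pi / 2))
    rw [h1, norm_smul, norm_mul, norm_pow, norm_pow, norm_neg, ← mul_pow, Real.norm_eq_abs,
      Real.norm_eq_abs, abs_of_pos Real.two_pi_pos] at h2
    calc (1 + ‖ξ‖) ^ m * ‖trigCoeff ξ φ g‖
        ≤ (2 * Real.pi * |(ξ i : ℝ)|) ^ m * ‖trigCoeff ξ φ g‖ := by gcongr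
      _ ≤ C i := h2
      _ ≤ ∑ i, C i := Finset.single_le_sum (fun j _ => hC0 j) (Finset.mem_univ i)
      _ ≤ D + ∑ i, C i := by linarith

lemma RapidDecay.summable_cos_smul [CompleteSpace F] {c : (Fin n → ℤ) → F} (hc : RapidDecay c)
    (φ : ℝ) (x : Fin n → ℝ) : Summable fun ξ => Real.cos (phase ξ x + φ) • c ξ := by
  refine (hc 0).of_norm_bounded fun ξ => ?_
  rw [norm_smul, pow_zero]
  gcongr
  exact Real.abs_cos_le_one _

lemma norm_phase_le (ξ : Fin n → ℤ) : ‖phase ξ‖ ≤ 2 * Real.pi * n * (1 + ‖ξ‖) := by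
  refine (phase ξ).opNorm_le_bound (by positivity) fun x => ?_
  rw [phase_apply]
  calc ‖∑ i, 2 * Real.pi * ξ i * x i‖ ≤ ∑ _i : Fin n, 2 * Real.pi * ‖ξ‖ * ‖x‖ := by
        refine norm_sum_le_of_le _ fun i _ => ?_
        rw [norm_mul, norm_mul, Real.norm_of_nonneg Real.two_pi_pos.le]
        gcongr
        · have := norm_le_pi_norm ξ i
          rw [Int.norm_eq_abs] at this
          rwa [Real.norm_eq_abs]
        · exact norm_le_pi_norm x i
    _ = 2 * Real.pi * n * ‖ξ‖ * ‖x‖ := by simp; ring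
    _ ≤ _ := by gcongr; linarith

lemma RapidDecay.two_pi_mul_smul {c : (Fin n → ℤ) → F} (hc : RapidDecay c) (i : Fin n) :
    RapidDecay fun ξ => (2 * Real.pi * (ξ i : ℝ)) • c ξ := by
  refine hc.mono (2 * Real.pi) 1 fun ξ => ?_
  rw [norm_smul, norm_mul, Real.norm_of_nonneg Real.two_pi_pos.le, pow_one]
  gcongr
  have := norm_le_pi_norm ξ i
  rw [Int.norm_eq_abs] at this
  rw [Real.norm_eq_abs]
  linarith

lemma pderivI_trigSeries [CompleteSpace F] {c : (Fin n → ℤ) → F} (hc : RapidDecay c) (φ : ℝ)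
    (i : Fin n) :
    pderivI i (trigSeries φ c)
      = trigSeries (φ + Real.pi / 2) fun ξ => (2 * Real.pi * (ξ i : ℝ)) • c ξ := by
  funext x
  have hu := ((hc 1).mul_left (2 * Real.pi * n))
  have hb : ∀ (ξ : Fin n → ℤ) (y : Fin n → ℝ),
      ‖(Real.cos (phase ξ y + φ + Real.pi / 2) • phase ξ).smulRight (c ξ)‖
        ≤ 2 * Real.pi * n * ((1 + ‖ξ‖) ^ 1 * ‖c ξ‖) := by
    intro ξ y
    rw [ContinuousLinearMap.norm_smulRight_apply, norm_smul, ← mul_assoc, pow_one]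
    exact mul_le_mul_of_nonneg_right
      ((mul_le_of_le_one_left (norm_nonneg _) (Real.abs_cos_le_one _)).trans (norm_phase_le ξ))
      (norm_nonneg _)
  have hd := hasFDerivAt_tsum hu (fun ξ y => (hasFDerivAt_cos_phase ξ φ y).smul_const (c ξ)) hb
    (hc.summable_cos_smul φ 0) x
  have hs : Summable fun ξ : Fin n → ℤ =>
      (Real.cos (phase ξ x + φ + Real.pi / 2) • phase ξ).smulRight (c ξ) :=
    hu.of_norm_bounded fun ξ => hb ξ x
  change fderiv ℝ (fun y => ∑' ξ, Real.cos (phase ξ y + φ) • c ξ) x (Pi.single i 1) = _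
  rw [hd.fderiv]
  have := (ContinuousLinearMap.apply ℝ F (Pi.single i (1 : ℝ) : Fin n → ℝ)).map_tsum hs
  simp only [ContinuousLinearMap.apply_apply] at this
  rw [this, trigSeries]
  refine tsum_congr fun ξ => ?_
  simp [phase_single, smul_smul, add_assoc]

lemma pderivWord_trigSeries [CompleteSpace F] {c : (Fin n → ℤ) → F} (hc : RapidDecay c) (φ : ℝ)
    (L : List (Fin n)) :
    (RapidDecay fun ξ : Fin n → ℤ =>
      ((2 * Real.pi) ^ L.length * (L.map fun i => (ξ i : ℝ)).prod) • c ξ) ∧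
    pderivWord L (trigSeries φ c) = trigSeries (φ + L.length * (Real.pi / 2))
      fun ξ => ((2 * Real.pi) ^ L.length * (L.map fun i => (ξ i : ℝ)).prod) • c ξ := by
  induction L with
  | nil => simpa [pderivWord_nil] using hc
  | cons i L ih =>
    have hcongr : (fun ξ : Fin n → ℤ => (2 * Real.pi * (ξ i : ℝ)) •
        ((2 * Real.pi) ^ L.length * (L.map fun i => (ξ i : ℝ)).prod) • c ξ)
        = fun ξ : Fin n → ℤ => ((2 * Real.pi) ^ (i :: L).length *
          ((i :: L).map fun i => (ξ i : ℝ)).prod) • c ξ := by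
      funext ξ
      rw [smul_smul, List.map_cons, List.prod_cons, List.length_cons]
      congr 1; ring
    rw [← hcongr]
    refine ⟨ih.1.two_pi_mul_smul i, ?_⟩
    rw [pderivWord_cons, ih.2, pderivI_trigSeries ih.1]
    congr 1
    rw [List.length_cons]; push_cast; ring

lemma diffOp_trigSeries [FiniteDimensional ℝ F] [FiniteDimensional ℝ G] {c : (Fin n → ℤ) → F}
    (hc : RapidDecay c) (φ : ℝ) (k : ℕ) (coef : (Fin n → ℕ) → (F →ₗ[ℝ] G)) :
    diffOp k coef (trigSeries φ c) = trigSeries (φ + k * (Real.pi / 2))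
      fun ξ => (2 * Real.pi) ^ k • symbolOf k coef (fun i => (ξ i : ℝ)) (c ξ) := by
  have := FiniteDimensional.complete ℝ F
  have := FiniteDimensional.complete ℝ G
  funext x
  have h1 : ∀ α ∈ Finset.Nat.antidiagonalTuple n k,
      HasSum (fun ξ : Fin n → ℤ => Real.cos (phase ξ x + (φ + k * (Real.pi / 2))) •
        ((2 * Real.pi) ^ k * ∏ i, (ξ i : ℝ) ^ α i) • coef α (c ξ))
        (coef α (pderivWord (wordOf α) (trigSeries φ c) x)) := by
    intro α hα
    obtain ⟨hd, he⟩ := pderivWord_trigSeries hc φ (wordOf α)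
    have hs := (hd.summable_cos_smul (φ + (wordOf α).length * (Real.pi / 2)) x).hasSum
    rw [he]
    have := (coef α).toContinuousLinearMap.hasSum hs
    simpa [length_wordOf_of_mem hα, prod_map_wordOf, trigSeries] using this
  rw [diffOp_eq_sum_pderivWord, ← (hasSum_sum h1).tsum_eq, trigSeries]
  refine tsum_congr fun ξ => ?_
  simp only [symbolOf, LinearMap.sum_apply, LinearMap.smul_apply, Finset.smul_sum, smul_smul]

lemma contDiff_trigSeries [CompleteSpace F] {c : (Fin n → ℤ) → F} (hc : RapidDecay c) (φ : ℝ) :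
    ContDiff ℝ (⊤ : ℕ∞) (trigSeries φ c) := by
  refine contDiff_tsum (v := fun k ξ => (2 * Real.pi * n) ^ k * ((1 + ‖ξ‖) ^ k * ‖c ξ‖))
    (fun ξ => (contDiff_cos_phase ξ φ).smul contDiff_const) (fun k _ => (hc k).mul_left _)
    fun k ξ x _ => ?_
  have hcos : ContDiff ℝ (⊤ : ℕ∞) fun t : ℝ => Real.cos (t + φ) :=
    Real.contDiff_cos.comp (contDiff_id.add contDiff_const)
  have h1 := (phase ξ).iteratedFDeriv_comp_right hcos x (i := k) (by exact_mod_cast le_top)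
  have h2 := (ContinuousLinearMap.toSpanSingleton ℝ (c ξ)).norm_iteratedFDeriv_comp_left
    (contDiff_cos_phase ξ φ).contDiffAt (x := x) (n := k) (by exact_mod_cast le_top)
  change ‖iteratedFDeriv ℝ k (ContinuousLinearMap.toSpanSingleton ℝ (c ξ) ∘
    fun y => Real.cos (phase ξ y + φ)) x‖ ≤ _
  refine h2.trans ?_
  rw [ContinuousLinearMap.norm_toSpanSingleton]
  have h3 : ‖iteratedFDeriv ℝ k (fun y => Real.cos (phase ξ y + φ)) x‖ ≤ ‖phase ξ‖ ^ k := by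
    change ‖iteratedFDeriv ℝ k ((fun t => Real.cos (t + φ)) ∘ phase ξ) x‖ ≤ _
    rw [h1]
    refine (ContinuousMultilinearMap.norm_compContinuousLinearMap_le _ _).trans ?_
    rw [iteratedFDeriv_comp_add_right, norm_iteratedFDeriv_eq_norm_iteratedDeriv]
    simp only [Finset.prod_const, Finset.card_univ, Fintype.card_fin]
    exact mul_le_of_le_one_left (by positivity) (Real.abs_iteratedDeriv_cos_le_one k _)
  calc ‖c ξ‖ * ‖iteratedFDeriv ℝ k (fun y => Real.cos (phase ξ y + φ)) x‖
      ≤ ‖c ξ‖ * (2 * Real.pi * n * (1 + ‖ξ‖)) ^ k := by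
        gcongr
        exact h3.trans (by gcongr; exact norm_phase_le ξ)
    _ = _ := by rw [mul_pow]; ring

lemma zperiodic_trigSeries (φ : ℝ) (c : (Fin n → ℤ) → F) : ZPeriodic (trigSeries φ c) :=
  fun x z => tsum_congr fun ξ => by
    have h := zperiodic_cos_phase ξ φ x z
    simp only at h
    rw [h]

end Decay

section Inversion

variable {n : ℕ} {F : Type*} [NormedAddCommGroup F] [NormedSpace ℝ F]

lemma mFourier_toTorus (ξ : Fin n → ℤ) (x : Fin n → ℝ) :
    UnitAddTorus.mFourier ξ (toTorus x) = Complex.exp ((phase ξ x : ℝ) * Complex.I) := by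
  change ∏ i, fourier (ξ i) ((x i : ℝ) : UnitAddCircle) = _
  simp only [fourier_coe_apply, phase_apply]
  rw [← Complex.exp_sum, Complex.ofReal_sum, Finset.sum_mul]
  congr 1
  refine Finset.sum_congr rfl fun i _ => ?_
  push_cast
  ring

lemma ZPeriodic.hasSum_fourier_real {g : (Fin n → ℝ) → ℝ} (hg : ZPeriodic g)
    (hc : ContDiff ℝ (⊤ : ℕ∞) g) (x : Fin n → ℝ) :
    HasSum (fun ξ => Real.cos (phase ξ x + 0) • trigCoeff ξ 0 g
      + Real.cos (phase ξ x + -(Real.pi / 2)) • trigCoeff ξ (-(Real.pi / 2)) g) (g x) := by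
  obtain ⟨g', hg'c, hg'⟩ := hg.exists_torus_lift hc.continuous
  let G : C(UnitAddTorus (Fin n), ℂ) := ⟨fun t => (g' t : ℂ), by fun_prop⟩
  have hcoeff : ∀ ξ, UnitAddTorus.mFourierCoeff G ξ
      = ((trigCoeff ξ 0 g : ℝ) : ℂ) - ((trigCoeff ξ (-(Real.pi / 2)) g : ℝ) : ℂ) * Complex.I := by
    intro ξ
    rw [UnitAddTorus.mFourierCoeff_eq_integral G ξ 0]
    have hset : {x : Fin n → ℝ | ∀ i, x i ∈ Set.Ioc ((0 : Fin n → ℝ) i) ((0 : Fin n → ℝ) i + 1)}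
        =ᵐ[volume] Set.Icc (0 : Fin n → ℝ) 1 := by
      have h := Measure.univ_pi_Ioc_ae_eq_Icc (μ := fun _ : Fin n => (volume : Measure ℝ))
        (f := 0) (g := 1)
      have hs : {x : Fin n → ℝ | ∀ i, x i ∈ Set.Ioc ((0 : Fin n → ℝ) i) ((0 : Fin n → ℝ) i + 1)}
          = Set.univ.pi fun i => Set.Ioc ((0 : Fin n → ℝ) i) ((1 : Fin n → ℝ) i) := by
        ext x; simp
      rw [hs]
      exact h
    rw [setIntegral_congr_set hset, trigCoeff, trigCoeff, ← integral_complex_ofReal,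
      ← integral_complex_ofReal, ← integral_mul_const, ← integral_sub]
    · refine integral_congr_ae (Filter.Eventually.of_forall fun y => ?_)
      change UnitAddTorus.mFourier (-ξ) (toTorus y) • ((g' (toTorus y) : ℝ) : ℂ) = _
      rw [hg', UnitAddTorus.mFourier_neg, mFourier_toTorus, Complex.exp_mul_I]
      simp only [← sub_eq_add_neg, Real.cos_sub_pi_div_two, add_zero, smul_eq_mul, map_add,
        map_mul, Complex.conj_I, ← Complex.ofReal_cos, ← Complex.ofReal_sin, Complex.conj_ofReal]
      push_cast
      ring
    · exact (integrableOn_cos_phase_smul hc.continuous ξ 0).ofReal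
    · exact ((integrableOn_cos_phase_smul hc.continuous ξ (-(Real.pi / 2))).ofReal).mul_const _
  have hd : ∀ φ, Summable fun ξ => ((trigCoeff ξ φ g : ℝ) : ℂ) := fun φ => by
    have := hg.rapidDecay_trigCoeff hc φ 0
    simp only [pow_zero, one_mul] at this
    exact Complex.ofRealCLM.summable this.of_norm
  have hsum : Summable (UnitAddTorus.mFourierCoeff G) := by
    rw [funext hcoeff]
    exact (hd 0).sub ((hd _).mul_right _)
  have h := Complex.hasSum_re
    (UnitAddTorus.hasSum_mFourier_series_apply_of_summable hsum (toTorus x))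
  have hG : (G (toTorus x)).re = g x := by
    change ((g' (toTorus x) : ℝ) : ℂ).re = _
    rw [hg', Complex.ofReal_re]
  rw [hG] at h
  convert h using 2 with ξ
  rw [hcoeff, mFourier_toTorus, Complex.exp_mul_I]
  simp [← sub_eq_add_neg, Real.cos_sub_pi_div_two, ← Complex.ofReal_cos, ← Complex.ofReal_sin]
  ring

/-- Fourier inversion for smooth periodic functions, in real form. -/
lemma ZPeriodic.eq_trigSeries [FiniteDimensional ℝ F] {g : (Fin n → ℝ) → F} (hg : ZPeriodic g)
    (hc : ContDiff ℝ (⊤ : ℕ∞) g) (x : Fin n → ℝ) :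
    g x = trigSeries 0 (fun ξ => trigCoeff ξ 0 g) x
      + trigSeries (-(Real.pi / 2)) (fun ξ => trigCoeff ξ (-(Real.pi / 2)) g) x := by
  have := FiniteDimensional.complete ℝ F
  rw [SeparatingDual.eq_iff_forall_dual_eq (R := ℝ)]
  intro T
  have h1 := ((hg.rapidDecay_trigCoeff hc 0).summable_cos_smul 0 x).hasSum.add
    ((hg.rapidDecay_trigCoeff hc (-(Real.pi / 2))).summable_cos_smul (-(Real.pi / 2)) x).hasSum
  have h2 := T.hasSum h1
  have hT : ZPeriodic fun x => T (g x) := fun x z => congrArg T (hg x z)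
  have h3 := hT.hasSum_fourier_real (T.contDiff.comp hc) x
  simp only [trigCoeff_clm_comp hc.continuous T, ← ContinuousLinearMap.map_smul, ← map_add] at h3
  exact h3.unique h2

lemma ZPeriodic.eq_zero_of_trigCoeff [FiniteDimensional ℝ F] {g : (Fin n → ℝ) → F}
    (hg : ZPeriodic g) (hc : ContDiff ℝ (⊤ : ℕ∞) g) (h : ∀ ξ φ, trigCoeff ξ φ g = 0)
    (x : Fin n → ℝ) : g x = 0 := by
  rw [hg.eq_trigSeries hc]
  simp [h, trigSeries]

end Inversion

section Symbol

variable {n : ℕ} {V W : Type*} [NormedAddCommGroup V] [NormedSpace ℝ V]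
  [NormedAddCommGroup W] [NormedSpace ℝ W]

lemma symbolOf_smul (k : ℕ) (coef : (Fin n → ℕ) → (V →ₗ[ℝ] W)) (t : ℝ) (ξ : Fin n → ℝ) :
    symbolOf k coef (t • ξ) = t ^ k • symbolOf k coef ξ := by
  unfold symbolOf
  rw [Finset.smul_sum]
  refine Finset.sum_congr rfl fun α hα => ?_
  rw [smul_smul, ← Finset.Nat.mem_antidiagonalTuple.1 hα, ← Finset.prod_pow_eq_pow_sum,
    ← Finset.prod_mul_distrib]
  simp [mul_pow]

lemma symbolOf_zero {k : ℕ} (hk : 1 ≤ k) (coef : (Fin n → ℕ) → (V →ₗ[ℝ] W)) :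
    symbolOf k coef 0 = 0 := by
  have h := symbolOf_smul k coef 0 (0 : Fin n → ℝ)
  rwa [zero_smul, zero_pow (by omega), zero_smul] at h

lemma exists_bounded_preimage_nhds [FiniteDimensional ℝ V] {E : Type*} [TopologicalSpace E]
    {T : E → (V →L[ℝ] W)} (hT : Continuous T) {e : E} {r : ℕ}
    (hr : ∀ᶠ x in nhds e, Module.finrank ℝ (LinearMap.range (T x : V →ₗ[ℝ] W)) = r) :
    ∃ C, ∀ᶠ x in nhds e, ∀ y ∈ LinearMap.range (T x : V →ₗ[ℝ] W), ∃ v, T x v = y ∧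
      ‖v‖ ≤ C * ‖y‖ := by
  obtain ⟨V₀, hV₀⟩ := (LinearMap.ker (T e : V →ₗ[ℝ] W)).exists_isCompl
  have hker : LinearMap.ker ((T e : V →ₗ[ℝ] W).domRestrict V₀) = ⊥ := by
    rw [LinearMap.ker_domRestrict]
    exact Submodule.disjoint_iff_comap_eq_bot.1 hV₀.symm.disjoint
  obtain ⟨K, hK0, hK⟩ := LinearMap.exists_antilipschitzWith _ hker
  have hlow : ∀ v ∈ V₀, ‖v‖ ≤ K * ‖T e v‖ := fun v hv => by
    have := hK.le_mul_dist (⟨v, hv⟩ : V₀) 0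
    simpa [dist_zero_right] using this
  have hVr : Module.finrank ℝ V₀ = r := by
    have h1 := Submodule.finrank_add_eq_of_isCompl hV₀
    have h2 := LinearMap.finrank_range_add_finrank_ker (T e : V →ₗ[ℝ] W)
    have h3 := hr.self_of_nhds
    omega
  have hK0' : (0 : ℝ) < K := by exact_mod_cast hK0
  have hnear : ∀ᶠ x in nhds e, ‖T x - T e‖ < (2 * (K : ℝ))⁻¹ := by
    have h : Filter.Tendsto (fun x => ‖T x - T e‖) (nhds e) (nhds ‖T e - T e‖) :=
      ((hT.sub continuous_const).norm).tendsto e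
    rw [sub_self, norm_zero] at h
    exact h.eventually_lt_const (by positivity)
  refine ⟨2 * K, ?_⟩
  filter_upwards [hnear, hr] with x hx hrx
  have hlow' : ∀ v ∈ V₀, ‖v‖ ≤ 2 * K * ‖T x v‖ := fun v hv => by
    have h1 := hlow v hv
    have h2 : ‖T e v‖ ≤ ‖T x v‖ + ‖(T x - T e) v‖ := by
      have : T e v = T x v - (T x - T e) v := by simp
      rw [this]
      exact norm_sub_le _ _
    have h3 : ‖(T x - T e) v‖ ≤ (2 * (K : ℝ))⁻¹ * ‖v‖ :=
      ((T x - T e).le_opNorm v).trans (by gcongr)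
    have h4 : (K : ℝ) * ((2 * (K : ℝ))⁻¹ * ‖v‖) = ‖v‖ / 2 := by field_simp
    have h5 : (K : ℝ) * ‖T e v‖ ≤ K * (‖T x v‖ + (2 * (K : ℝ))⁻¹ * ‖v‖) := by
      gcongr
      linarith
    rw [mul_add, h4] at h5
    linarith
  have hinj : Function.Injective ((T x : V →ₗ[ℝ] W).domRestrict V₀) := by
    rw [← LinearMap.ker_eq_bot, LinearMap.ker_eq_bot']
    intro v hv
    have h := hlow' v v.2
    have h0 : T x v = 0 := hv
    rw [h0, norm_zero, mul_zero] at h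
    exact Subtype.ext (norm_le_zero_iff.1 h)
  have hrange : LinearMap.range ((T x : V →ₗ[ℝ] W).domRestrict V₀)
      = LinearMap.range (T x : V →ₗ[ℝ] W) := by
    refine Submodule.eq_of_le_of_finrank_eq ?_ ?_
    · rintro _ ⟨v, rfl⟩
      exact ⟨v, rfl⟩
    · rw [LinearMap.finrank_range_of_inj hinj, hrx, hVr]
  intro y hy
  rw [← hrange] at hy
  obtain ⟨v, rfl⟩ := hy
  exact ⟨v, rfl, hlow' v v.2⟩

lemma exists_bounded_preimage_symbolOf [FiniteDimensional ℝ V] (k : ℕ)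
    (coef : (Fin n → ℕ) → (V →ₗ[ℝ] W)) {r : ℕ}
    (hr : ∀ ξ : Fin n → ℝ, ξ ≠ 0 →
      Module.finrank ℝ (LinearMap.range (symbolOf k coef ξ)) = r) :
    ∃ C, ∀ ξ : Fin n → ℝ, 1 ≤ ‖ξ‖ → ∀ y ∈ LinearMap.range (symbolOf k coef ξ),
      ∃ v, symbolOf k coef ξ v = y ∧ ‖v‖ ≤ C * ‖y‖ := by
  let T : (Fin n → ℝ) → (V →L[ℝ] W) := fun ξ =>
    ∑ α ∈ Finset.Nat.antidiagonalTuple n k, (∏ i, ξ i ^ α i) • (coef α).toContinuousLinearMap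
  have hTc : Continuous T := by fun_prop
  have hT : ∀ ξ, (T ξ : V →ₗ[ℝ] W) = symbolOf k coef ξ := fun ξ => by
    ext v
    simp [T, symbolOf]
  have hsphere : ∃ C, ∀ ξ ∈ Metric.sphere (0 : Fin n → ℝ) 1,
      ∀ y ∈ LinearMap.range (symbolOf k coef ξ), ∃ v, symbolOf k coef ξ v = y ∧
        ‖v‖ ≤ C * ‖y‖ := by
    refine (isCompact_sphere (0 : Fin n → ℝ) 1).induction_on
      (p := fun S => ∃ C, ∀ ξ ∈ S, ∀ y ∈ LinearMap.range (symbolOf k coef ξ),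
        ∃ v, symbolOf k coef ξ v = y ∧ ‖v‖ ≤ C * ‖y‖) ⟨0, by simp⟩ ?_ ?_ ?_
    · rintro s t hst ⟨C, hC⟩
      exact ⟨C, fun ξ hξ => hC ξ (hst hξ)⟩
    · rintro s t ⟨C, hC⟩ ⟨D, hD⟩
      refine ⟨max C D, fun ξ hξ y hy => ?_⟩
      rcases hξ with hξ | hξ
      · obtain ⟨v, h1, h2⟩ := hC ξ hξ y hy
        exact ⟨v, h1, h2.trans (by gcongr; exact le_max_left _ _)⟩
      · obtain ⟨v, h1, h2⟩ := hD ξ hξ y hy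
        exact ⟨v, h1, h2.trans (by gcongr; exact le_max_right _ _)⟩
    · intro ξ hξ
      have hξ0 : ξ ≠ 0 := by
        rintro rfl
        simp at hξ
      have hev : ∀ᶠ x in nhds ξ,
          Module.finrank ℝ (LinearMap.range (T x : V →ₗ[ℝ] W)) = r := by
        filter_upwards [isOpen_ne.mem_nhds hξ0] with x hx
        rw [hT]
        exact hr x hx
      obtain ⟨C, hC⟩ := exists_bounded_preimage_nhds hTc hev
      refine ⟨_, mem_nhdsWithin_of_mem_nhds hC, C, fun x hx y hy => ?_⟩
      rw [← hT] at hy ⊢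
      exact hx y hy
  obtain ⟨C, hC⟩ := hsphere
  refine ⟨C, fun ξ hξ y hy => ?_⟩
  have hpos : 0 < ‖ξ‖ := by linarith
  have hs : ‖ξ‖⁻¹ • ξ ∈ Metric.sphere (0 : Fin n → ℝ) 1 := by
    simp [norm_smul, hpos.ne']
  have hy' : y ∈ LinearMap.range (symbolOf k coef (‖ξ‖⁻¹ • ξ)) := by
    obtain ⟨v, rfl⟩ := hy
    refine ⟨‖ξ‖ ^ k • v, ?_⟩
    rw [symbolOf_smul, LinearMap.smul_apply, map_smul, smul_smul, ← mul_pow,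
      inv_mul_cancel₀ hpos.ne', one_pow, one_smul]
  obtain ⟨v, rfl, h2⟩ := hC _ hs y hy'
  refine ⟨(‖ξ‖⁻¹) ^ k • v, ?_, ?_⟩
  · rw [symbolOf_smul, LinearMap.smul_apply, map_smul]
  · refine le_trans ?_ h2
    rw [norm_smul, norm_pow, norm_inv, norm_norm]
    exact mul_le_of_le_one_left (norm_nonneg _)
      (pow_le_one₀ (by positivity) (inv_le_one_of_one_le₀ hξ))

end Symbol

section Potential

variable {n : ℕ} {V W X : Type*} [NormedAddCommGroup V] [NormedSpace ℝ V] [FiniteDimensional ℝ V]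
  [NormedAddCommGroup W] [NormedSpace ℝ W] [FiniteDimensional ℝ W]
  [NormedAddCommGroup X] [NormedSpace ℝ X] [FiniteDimensional ℝ X]

lemma intCast_ne_zero {ξ : Fin n → ℤ} (hξ : ξ ≠ 0) : (fun i => (ξ i : ℝ)) ≠ 0 := by
  contrapose! hξ
  funext i
  simpa using congrFun hξ i

lemma one_le_norm_intCast {ξ : Fin n → ℤ} (hξ : ξ ≠ 0) : 1 ≤ ‖fun i => (ξ i : ℝ)‖ := by
  obtain ⟨i, hi⟩ := Function.ne_iff.1 hξ
  refine le_trans ?_ (norm_le_pi_norm (fun i => (ξ i : ℝ)) i)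
  rw [Real.norm_eq_abs]
  exact_mod_cast Int.one_le_abs hi

/-- A smooth periodic mean-zero field in the kernel of an operator with exact symbol sequence
has a smooth periodic potential. -/
lemma exists_potential {k l : ℕ} {Acoef : (Fin n → ℕ) → (W →ₗ[ℝ] X)}
    {Bcoef : (Fin n → ℕ) → (V →ₗ[ℝ] W)}
    (hBrank : ∃ s : ℕ, ∀ ξ : Fin n → ℝ, ξ ≠ 0 →
      Module.finrank ℝ (LinearMap.range (symbolOf l Bcoef ξ)) = s)
    (hexact : ∀ ξ : Fin n → ℝ, ξ ≠ 0 →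
      LinearMap.ker (symbolOf k Acoef ξ) = LinearMap.range (symbolOf l Bcoef ξ))
    {w : (Fin n → ℝ) → W} (hc : ContDiff ℝ (⊤ : ℕ∞) w) (hw : ZPeriodic w)
    (hA : ∀ x, diffOp k Acoef w x = 0) (h_int : (∫ x in Set.Icc (0 : Fin n → ℝ) 1, w x) = 0) :
    ∃ v : (Fin n → ℝ) → V, ContDiff ℝ (⊤ : ℕ∞) v ∧ ZPeriodic v ∧
      ∀ x, diffOp l Bcoef v x = w x := by
  have := FiniteDimensional.complete ℝ V
  have := FiniteDimensional.complete ℝ W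
  obtain ⟨s, hs⟩ := hBrank
  obtain ⟨C, hC⟩ := exists_bounded_preimage_symbolOf l Bcoef hs
  have hker : ∀ (ξ : Fin n → ℤ) (φ : ℝ),
      trigCoeff ξ φ w ∈ LinearMap.ker (symbolOf k Acoef fun i => (ξ i : ℝ)) := by
    intro ξ φ
    have h := trigCoeff_diffOp hw hc k Acoef ξ (φ - k * (Real.pi / 2))
    have h0 : trigCoeff ξ (φ - k * (Real.pi / 2)) (diffOp k Acoef w) = 0 := by
      simp [trigCoeff, hA]
    rw [h0, sub_add_cancel, eq_comm, smul_eq_zero] at h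
    exact h.resolve_left (pow_ne_zero _ (neg_ne_zero.2 Real.two_pi_pos.ne'))
  have hsol : ∀ φ, ∃ d : (Fin n → ℤ) → V, RapidDecay d ∧ ∀ ξ,
      (2 * Real.pi) ^ l • symbolOf l Bcoef (fun i => (ξ i : ℝ)) (d ξ) = trigCoeff ξ φ w := by
    intro φ
    have hpt : ∀ ξ : Fin n → ℤ, ∃ d : V,
        (2 * Real.pi) ^ l • symbolOf l Bcoef (fun i => (ξ i : ℝ)) d = trigCoeff ξ φ w ∧
          ‖d‖ ≤ max C 0 * ‖trigCoeff ξ φ w‖ := by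
      intro ξ
      rcases eq_or_ne ξ 0 with rfl | hξ
      · have h0 : trigCoeff (0 : Fin n → ℤ) φ w = 0 := by
          simp [trigCoeff, phase_apply, integral_smul, h_int]
        exact ⟨0, by simp [h0], by simp [h0]⟩
      · have hmem := hker ξ φ
        rw [hexact _ (intCast_ne_zero hξ)] at hmem
        obtain ⟨v, hv, hvC⟩ := hC _ (one_le_norm_intCast hξ) _ hmem
        have h2π : (0 : ℝ) < (2 * Real.pi) ^ l := pow_pos Real.two_pi_pos l
        refine ⟨((2 * Real.pi) ^ l)⁻¹ • v, ?_, ?_⟩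
        · rw [map_smul, smul_smul, mul_inv_cancel₀ h2π.ne', one_smul, hv]
        · rw [norm_smul, norm_inv, Real.norm_of_nonneg h2π.le]
          calc ((2 * Real.pi) ^ l)⁻¹ * ‖v‖ ≤ 1 * ‖v‖ := by
                gcongr
                exact inv_le_one_of_one_le₀ (one_le_pow₀ (by linarith [Real.pi_gt_three]))
            _ ≤ max C 0 * ‖trigCoeff ξ φ w‖ := by
                rw [one_mul]
                exact hvC.trans (by gcongr; exact le_max_left _ _)
    choose d hd hdC using hpt
    refine ⟨d, (hw.rapidDecay_trigCoeff hc φ).mono (max C 0) 0 fun ξ => ?_, hd⟩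
    simpa using hdC ξ
  obtain ⟨d₀, hd₀, he₀⟩ := hsol 0
  obtain ⟨d₁, hd₁, he₁⟩ := hsol (-(Real.pi / 2))
  refine ⟨fun x => trigSeries (0 - l * (Real.pi / 2)) d₀ x
    + trigSeries (-(Real.pi / 2) - l * (Real.pi / 2)) d₁ x,
    (contDiff_trigSeries hd₀ _).add (contDiff_trigSeries hd₁ _), fun x z => ?_, fun x => ?_⟩
  · simp only [zperiodic_trigSeries _ _ x z]
  · rw [diffOp_add (contDiff_trigSeries hd₀ _) (contDiff_trigSeries hd₁ _), diffOp_trigSeries hd₀,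
      diffOp_trigSeries hd₁, sub_add_cancel, sub_add_cancel, hw.eq_trigSeries hc x]
    simp only [he₀, he₁]

/-- The potential operator maps smooth periodic fields to competitors. -/
lemma diffOp_diffOp_eq_zero {k l : ℕ} (hk : 1 ≤ k) {Acoef : (Fin n → ℕ) → (W →ₗ[ℝ] X)}
    {Bcoef : (Fin n → ℕ) → (V →ₗ[ℝ] W)}
    (hexact : ∀ ξ : Fin n → ℝ, ξ ≠ 0 →
      LinearMap.ker (symbolOf k Acoef ξ) = LinearMap.range (symbolOf l Bcoef ξ))
    {v : (Fin n → ℝ) → V} (hc : ContDiff ℝ (⊤ : ℕ∞) v) (hv : ZPeriodic v) (x : Fin n → ℝ) :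
    diffOp k Acoef (diffOp l Bcoef v) x = 0 := by
  have hcB := hc.diffOp l Bcoef
  have hvB := hv.diffOp l Bcoef
  refine (hvB.diffOp k Acoef).eq_zero_of_trigCoeff (hcB.diffOp k Acoef) (fun ξ φ => ?_) x
  rw [trigCoeff_diffOp hvB hcB, trigCoeff_diffOp hv hc]
  rcases eq_or_ne ξ 0 with rfl | hξ
  · have h0 : (fun i : Fin n => (((0 : Fin n → ℤ) i : ℤ) : ℝ)) = 0 := by
      funext i; simp
    rw [h0, symbolOf_zero hk, LinearMap.zero_apply, smul_zero]
  · have hmem : ∀ y, symbolOf l Bcoef (fun i => (ξ i : ℝ)) y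
        ∈ LinearMap.ker (symbolOf k Acoef fun i => (ξ i : ℝ)) := fun y => by
      rw [hexact _ (intCast_ne_zero hξ)]
      exact ⟨y, rfl⟩
    rw [map_smul, LinearMap.mem_ker.1 (hmem _), smul_zero, smul_zero]

lemma setIntegral_diffOp_eq_zero {l : ℕ} (hl : 1 ≤ l) {Bcoef : (Fin n → ℕ) → (V →ₗ[ℝ] W)}
    {v : (Fin n → ℝ) → V} (hc : ContDiff ℝ (⊤ : ℕ∞) v) (hv : ZPeriodic v) :
    (∫ x in Set.Icc (0 : Fin n → ℝ) 1, diffOp l Bcoef v x) = 0 := by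
  have h := trigCoeff_diffOp hv hc l Bcoef 0 0
  have h0 : (fun i : Fin n => (((0 : Fin n → ℤ) i : ℤ) : ℝ)) = 0 := by
    funext i; simp
  rw [h0, symbolOf_zero hl, LinearMap.zero_apply, smul_zero] at h
  simpa [trigCoeff, phase_apply] using h

end Potential

section Periodization

variable {n : ℕ} {V W : Type*} [NormedAddCommGroup V] [NormedSpace ℝ V]
  [NormedAddCommGroup W] [NormedSpace ℝ W]

lemma isOpen_openUnitCube (n : ℕ) : IsOpen (openUnitCube n) :=
  isOpen_set_pi Set.finite_univ fun _ _ => isOpen_Ioo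

lemma openUnitCube_ae_eq_Icc (n : ℕ) :
    openUnitCube n =ᵐ[volume] Set.Icc (0 : Fin n → ℝ) 1 :=
  Measure.univ_pi_Ioo_ae_eq_Icc (μ := fun _ : Fin n => (volume : Measure ℝ)) (f := 0) (g := 1)

lemma openUnitCube_subset_Icc (n : ℕ) : openUnitCube n ⊆ Set.Icc (0 : Fin n → ℝ) 1 :=
  fun _ hx => ⟨fun i => (hx i trivial).1.le, fun i => (hx i trivial).2.le⟩

lemma isCompact_of_isClosed_subset_openUnitCube {K : Set (Fin n → ℝ)} (hK : IsClosed K)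
    (h : K ⊆ openUnitCube n) : IsCompact K :=
  isCompact_Icc.of_isClosed_subset hK (h.trans (openUnitCube_subset_Icc n))

lemma exists_gap_of_tsupport_subset {V : Type*} [NormedAddCommGroup V] {u : (Fin n → ℝ) → V}
    (hu : tsupport u ⊆ openUnitCube n) :
    ∃ δ > 0, ∀ x, u x ≠ 0 → ∀ i, δ < x i ∧ x i < 1 - δ := by
  obtain ⟨δ, hδ, hsub⟩ := (isCompact_of_isClosed_subset_openUnitCube (isClosed_tsupport u)
    hu).exists_cthickening_subset_open (isOpen_openUnitCube n) hu
  refine ⟨δ, hδ, fun x hx i => ?_⟩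
  have hxt : x ∈ tsupport u := subset_tsupport u hx
  have hxi := hu hxt i trivial
  have hmem : ∀ t, |t - x i| ≤ δ → t ∈ Set.Ioo (0 : ℝ) 1 := by
    intro t ht
    have h1 : Function.update x i t ∈ Metric.cthickening δ (tsupport u) := by
      refine Metric.mem_cthickening_of_dist_le _ x δ _ hxt ((dist_pi_le_iff hδ.le).2 fun j => ?_)
      rcases eq_or_ne j i with rfl | hj
      · simpa [Real.dist_eq] using ht
      · simp [Function.update_of_ne hj, hδ.le]
    simpa using hsub h1 i trivial
  constructor
  · by_contra! h
    exact lt_irrefl _ (hmem 0 (by rw [zero_sub, abs_neg, abs_of_pos hxi.1]; exact h)).1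
  · by_contra! h
    exact lt_irrefl _ (hmem 1 (by rw [abs_of_pos (by linarith [hxi.2])]; linarith)).2

/-- A smooth function supported in the open unit cube extends periodically. -/
lemma exists_periodization {u : (Fin n → ℝ) → V} (hc : ContDiff ℝ (⊤ : ℕ∞) u)
    (hu : tsupport u ⊆ openUnitCube n) :
    ∃ v : (Fin n → ℝ) → V, ContDiff ℝ (⊤ : ℕ∞) v ∧ ZPeriodic v ∧
      ∀ x ∈ openUnitCube n, v =ᶠ[nhds x] u := by
  obtain ⟨δ, hδ, hgap⟩ := exists_gap_of_tsupport_subset hu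
  refine ⟨fun x => u fun i => Int.fract (x i), contDiff_iff_contDiffAt.2 fun x => ?_,
    fun x z => ?_, fun x hx => ?_⟩
  · by_cases hx : ∃ i, Int.fract (x i) = 0
    · obtain ⟨i, hi⟩ := hx
      have hev : (fun x => u fun i => Int.fract (x i)) =ᶠ[nhds x] fun _ => 0 := by
        have hnear : ∀ᶠ y : Fin n → ℝ in nhds x, |y i - x i| < δ := by
          have h : Filter.Tendsto (fun y : Fin n → ℝ => |y i - x i|) (nhds x)
              (nhds |x i - x i|) := Continuous.tendsto (by fun_prop) x
          rw [sub_self, abs_zero] at h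
          exact h.eventually_lt_const hδ
        filter_upwards [hnear] with y hy
        by_contra hne
        have h := hgap _ hne i
        have hyi := Int.floor_add_fract (y i)
        have hxi := Int.floor_add_fract (x i)
        rw [abs_lt] at hy
        have h1 : (⌊y i⌋ : ℝ) < ⌊x i⌋ := by linarith [h.1]
        have h2 : (⌊x i⌋ : ℝ) < ⌊y i⌋ + 1 := by linarith [h.2]
        have h3 : ⌊y i⌋ < ⌊x i⌋ := by exact_mod_cast h1
        have h4 : ⌊x i⌋ < ⌊y i⌋ + 1 := by exact_mod_cast h2
        omega
      exact contDiffAt_const.congr_of_eventuallyEq hev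
    · push Not at hx
      have hfloor : ∀ i, ∀ᶠ y : Fin n → ℝ in nhds x, ⌊y i⌋ = ⌊x i⌋ := by
        intro i
        have h1 : (⌊x i⌋ : ℝ) < x i := by
          have := Int.floor_add_fract (x i)
          have := (Int.fract_nonneg (x i)).lt_of_ne' (hx i)
          linarith
        have h2 : x i < (⌊x i⌋ : ℝ) + 1 := Int.lt_floor_add_one _
        have h3 : ∀ᶠ y : Fin n → ℝ in nhds x, y i ∈ Set.Ioo (⌊x i⌋ : ℝ) (⌊x i⌋ + 1) :=
          (continuous_apply i).continuousAt.eventually (isOpen_Ioo.mem_nhds ⟨h1, h2⟩)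
        filter_upwards [h3] with y hy
        exact Int.floor_eq_iff.2 ⟨hy.1.le, hy.2⟩
      have hev : (fun x => u fun i => Int.fract (x i)) =ᶠ[nhds x]
          fun y => u (y - fun i => (⌊x i⌋ : ℝ)) := by
        filter_upwards [Filter.eventually_all.2 hfloor] with y hy
        congr 1
        funext i
        rw [Int.fract, hy i, Pi.sub_apply]
      exact (hc.comp (contDiff_id.sub contDiff_const)).contDiffAt.congr_of_eventuallyEq hev
  · simp [Int.fract_add_intCast]
  · filter_upwards [(isOpen_openUnitCube n).mem_nhds hx] with y hy
    congr 1
    funext i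
    exact Int.fract_eq_self.2 ⟨(hy i trivial).1.le, (hy i trivial).2⟩

end Periodization

section Cutoff

/-- A smooth function on the line that is constant far out on either side has bounded
derivatives. -/
lemma uniformlySmooth_smoothTransition :
    UniformlySmooth fun (_ : Unit) (t : ℝ) => Real.smoothTransition (2 * t - 1) := by
  have hc : ContDiff ℝ (⊤ : ℕ∞) fun t : ℝ => Real.smoothTransition (2 * t - 1) :=
    Real.smoothTransition.contDiff.comp ((contDiff_const.mul contDiff_id).sub contDiff_const)
  refine ⟨fun _ => hc, fun j => ?_⟩
  obtain ⟨C, hC⟩ := (isCompact_Icc (a := (0 : ℝ)) (b := 2)).exists_bound_of_continuousOn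
    (hc.continuous_iteratedFDeriv (m := j) (by exact_mod_cast le_top)).continuousOn
  refine ⟨max C 1, by positivity, fun _ t => ?_⟩
  by_cases ht : t ∈ Set.Icc (0 : ℝ) 2
  · exact (hC t ht).trans (le_max_left _ _)
  · rcases j with _ | j
    · rw [norm_iteratedFDeriv_zero, Real.norm_of_nonneg (Real.smoothTransition.nonneg _)]
      exact (Real.smoothTransition.le_one _).trans (le_max_right _ _)
    · have hev : ∃ c : ℝ, (fun t : ℝ => Real.smoothTransition (2 * t - 1)) =ᶠ[nhds t]
          fun _ => c := by
        rw [Set.mem_Icc, not_and_or, not_le, not_le] at ht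
        rcases ht with ht | ht
        · refine ⟨0, ?_⟩
          filter_upwards [Iio_mem_nhds ht] with s hs
          exact Real.smoothTransition.zero_of_nonpos (by linarith [Set.mem_Iio.1 hs])
        · refine ⟨1, ?_⟩
          filter_upwards [Ioi_mem_nhds ht] with s hs
          exact Real.smoothTransition.one_of_one_le (by linarith [Set.mem_Ioi.1 hs])
      obtain ⟨c, hc⟩ := hev
      rw [(hc.iteratedFDeriv ℝ (j + 1)).eq_of_nhds, iteratedFDeriv_const_of_ne (by omega)]
      simp

/-- Cutoff functions for the cubes `[0,N]ⁿ` whose transition layers have width independent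
of `N`. -/
lemma exists_cutoff (n : ℕ) : ∃ ψ : ℕ → (Fin n → ℝ) → ℝ, UniformlySmooth ψ ∧
    (∀ N y, ψ N y ≠ 0 → ∀ i, 1 / 2 ≤ y i ∧ y i ≤ (N : ℝ) - 1 / 2) ∧
    ∀ (N : ℕ) y, (∀ i, 1 ≤ y i ∧ y i ≤ (N : ℝ) - 1) → ψ N y = 1 := by
  have hχ := uniformlySmooth_smoothTransition
  refine ⟨fun N y => ∏ i, Real.smoothTransition (2 * y i - 1) •
    Real.smoothTransition (2 * (-y i + N) - 1), ?_, fun N y h i => ?_, fun N y h => ?_⟩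
  · refine UniformlySmooth.prod (fun i => UniformlySmooth.smul ?_ ?_) _
    · exact (hχ.reindex fun _ : ℕ => ()).comp_clm
        (ContinuousLinearMap.proj i : (Fin n → ℝ) →L[ℝ] ℝ)
    · exact ((hχ.reindex fun _ : ℕ => ()).comp_add fun N : ℕ => (N : ℝ)).comp_clm
        (-ContinuousLinearMap.proj i : (Fin n → ℝ) →L[ℝ] ℝ)
  · have hi := Finset.prod_ne_zero_iff.1 h i (Finset.mem_univ i)
    rw [smul_eq_mul, mul_ne_zero_iff] at hi
    constructor
    · by_contra! hlt
      exact hi.1 (Real.smoothTransition.zero_of_nonpos (by linarith))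
    · by_contra! hlt
      exact hi.2 (Real.smoothTransition.zero_of_nonpos (by linarith))
  · refine Finset.prod_eq_one fun i _ => ?_
    rw [Real.smoothTransition.one_of_one_le (by linarith [(h i).1]),
      Real.smoothTransition.one_of_one_le (by linarith [(h i).2]), smul_eq_mul, mul_one]

end Cutoff

section Holder

variable {E V : Type*} [NormedAddCommGroup E] [NormedSpace ℝ E]
  [NormedAddCommGroup V] [NormedSpace ℝ V]

lemma norm_iteratedFDeriv_rescale_le {f : E → V} (hf : ContDiff ℝ (⊤ : ℕ∞) f) (r t : ℝ) (j : ℕ)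
    (x : E) : ‖iteratedFDeriv ℝ j (fun y => r • f (t • y)) x‖
      ≤ |r| * |t| ^ j * ‖iteratedFDeriv ℝ j f (t • x)‖ := by
  let L : E →L[ℝ] E := t • ContinuousLinearMap.id ℝ E
  have hL : ‖L‖ ≤ |t| := by
    refine L.opNorm_le_bound (abs_nonneg t) fun y => ?_
    simp [L, norm_smul]
  have hcomp : ContDiff ℝ (⊤ : ℕ∞) (f ∘ L) := hf.comp L.contDiff
  have h1 : iteratedFDeriv ℝ j (fun y => r • f (t • y)) x
      = r • iteratedFDeriv ℝ j (f ∘ L) x :=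
    iteratedFDeriv_const_smul_apply (hcomp.of_le (by exact_mod_cast le_top)).contDiffAt
  rw [h1, norm_smul, Real.norm_eq_abs, mul_assoc,
    L.iteratedFDeriv_comp_right hf x (i := j) (by exact_mod_cast le_top)]
  gcongr
  refine (ContinuousMultilinearMap.norm_compContinuousLinearMap_le _ _).trans ?_
  rw [Finset.prod_const, Finset.card_univ, Fintype.card_fin, mul_comm]
  change ‖L‖ ^ j * ‖iteratedFDeriv ℝ j f (t • x)‖ ≤ _
  gcongr

lemma norm_iteratedFDeriv_sub_le {f : E → V} (hf : ContDiff ℝ (⊤ : ℕ∞) f) {j : ℕ} {C : ℝ}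
    (hC : ∀ x, ‖iteratedFDeriv ℝ (j + 1) f x‖ ≤ C) (x y : E) :
    ‖iteratedFDeriv ℝ j f x - iteratedFDeriv ℝ j f y‖ ≤ C * ‖x - y‖ :=
  convex_univ.norm_image_sub_le_of_norm_fderiv_le (𝕜 := ℝ)
    (fun z _ => (hf.differentiable_iteratedFDeriv (m := j)
      (by exact_mod_cast WithTop.coe_lt_top _)).differentiableAt)
    (fun z _ => by rw [norm_fderiv_iteratedFDeriv]; exact hC z) trivial trivial

lemma eventually_holderNorm_lt {n l : ℕ} (hl : 1 ≤ l) {a : ℝ} (ha0 : 0 ≤ a) (ha1 : a < 1)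
    {H : ℕ → EuclideanSpace ℝ (Fin n) → V} (hH : UniformlySmooth H) {ε : ℝ} (hε : 0 < ε) :
    ∀ᶠ N : ℕ in Filter.atTop,
      holderNorm l a (fun x => ((N : ℝ) ^ l)⁻¹ • H N ((N : ℝ) • x)) < ε := by
  choose C hC0 hC using hH.2
  set M : ℝ := max (2 * C (l - 1)) (C l) with hM
  have hM0 : 0 ≤ M := le_max_of_le_right (hC0 l)
  have hlim : Filter.Tendsto (fun N : ℕ => (∑ j ∈ Finset.range l, C j) * (N : ℝ)⁻¹
      + (M * (N : ℝ)⁻¹) ^ (1 - a) * M ^ a) Filter.atTop (nhds 0) := by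
    have h1 : Filter.Tendsto (fun N : ℕ => (N : ℝ)⁻¹) Filter.atTop (nhds 0) :=
      tendsto_inv_atTop_nhds_zero_nat
    have h2 := (((h1.const_mul M).rpow_const (p := 1 - a)
      (Or.inr (by linarith))).mul_const (M ^ a))
    have h3 := (h1.const_mul (∑ j ∈ Finset.range l, C j)).add h2
    simpa [Real.zero_rpow (by linarith : 1 - a ≠ 0)] using h3
  filter_upwards [hlim.eventually_lt_const hε, Filter.eventually_ge_atTop 1] with N hN hN1
  refine lt_of_le_of_lt ?_ hN
  have hNr : (1 : ℝ) ≤ N := by exact_mod_cast hN1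
  have hN0 : (0 : ℝ) < N := by linarith
  have hcd : ContDiff ℝ (⊤ : ℕ∞) fun x => ((N : ℝ) ^ l)⁻¹ • H N ((N : ℝ) • x) :=
    contDiff_const.smul ((hH.1 N).comp (contDiff_const_smul (N : ℝ)))
  have hbd : ∀ j x, ‖iteratedFDeriv ℝ j (fun x => ((N : ℝ) ^ l)⁻¹ • H N ((N : ℝ) • x)) x‖
      ≤ ((N : ℝ) ^ l)⁻¹ * (N : ℝ) ^ j * C j := fun j x => by
    refine (norm_iteratedFDeriv_rescale_le (hH.1 N) _ _ j x).trans ?_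
    rw [abs_of_nonneg (by positivity), abs_of_nonneg hN0.le]
    gcongr
    exact hC j N _
  have hlow : ∀ j < l, ∀ x,
      ‖iteratedFDeriv ℝ j (fun x => ((N : ℝ) ^ l)⁻¹ • H N ((N : ℝ) • x)) x‖
        ≤ C j * (N : ℝ)⁻¹ := fun j hj x => by
    refine (hbd j x).trans ?_
    rw [mul_comm (C j)]
    refine mul_le_mul_of_nonneg_right ?_ (hC0 j)
    rw [inv_mul_le_iff₀ (by positivity), ← div_eq_mul_inv, le_div_iff₀ hN0, ← pow_succ]
    exact pow_le_pow_right₀ hNr hj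
  unfold holderNorm
  refine add_le_add ?_ ?_
  · rw [Finset.sum_mul]
    refine Finset.sum_le_sum fun j hj => Real.iSup_le (hlow j (Finset.mem_range.1 hj)) ?_
    have := hC0 j
    positivity
  · refine Real.iSup_le (fun p => ?_) (by positivity)
    obtain ⟨⟨x, y⟩, hxy⟩ := p
    have hd : 0 < ‖x - y‖ := norm_pos_iff.2 (sub_ne_zero.2 hxy)
    rw [div_le_iff₀ (by positivity)]
    set z := ‖iteratedFDeriv ℝ (l - 1) (fun x => ((N : ℝ) ^ l)⁻¹ • H N ((N : ℝ) • x)) x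
      - iteratedFDeriv ℝ (l - 1) (fun x => ((N : ℝ) ^ l)⁻¹ • H N ((N : ℝ) • x)) y‖ with hz
    have hz0 : 0 ≤ z := norm_nonneg _
    have hz1 : z ≤ M * (N : ℝ)⁻¹ := by
      have h1 := hlow (l - 1) (by omega) x
      have h2 := hlow (l - 1) (by omega) y
      have h3 : 2 * C (l - 1) * (N : ℝ)⁻¹ ≤ M * (N : ℝ)⁻¹ := by
        gcongr
        exact le_max_left _ _
      exact (norm_sub_le _ _).trans (by linarith)
    have hz2 : z ≤ M * ‖x - y‖ := by
      have hCl : ∀ x, ‖iteratedFDeriv ℝ (l - 1 + 1)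
          (fun x => ((N : ℝ) ^ l)⁻¹ • H N ((N : ℝ) • x)) x‖ ≤ C l := fun x => by
        rw [Nat.sub_add_cancel hl]
        refine (hbd l x).trans (le_of_eq ?_)
        rw [inv_mul_cancel₀ (by positivity), one_mul]
      refine (norm_iteratedFDeriv_sub_le hcd hCl x y).trans ?_
      gcongr
      exact le_max_right _ _
    calc z = z ^ (1 - a) * z ^ a := by
          rw [← Real.rpow_add_of_nonneg hz0 (by linarith) ha0, sub_add_cancel, Real.rpow_one]
      _ ≤ (M * (N : ℝ)⁻¹) ^ (1 - a) * (M * ‖x - y‖) ^ a := by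
          have : 0 ≤ 1 - a := by linarith
          gcongr
      _ = (M * (N : ℝ)⁻¹) ^ (1 - a) * M ^ a * ‖x - y‖ ^ a := by
          rw [Real.mul_rpow hM0 hd.le, mul_assoc]

end Holder

section Envelope

variable {n : ℕ} {V W X : Type*} [NormedAddCommGroup V] [NormedSpace ℝ V] [FiniteDimensional ℝ V]
  [NormedAddCommGroup W] [NormedSpace ℝ W]
  [NormedAddCommGroup X] [NormedSpace ℝ X] [FiniteDimensional ℝ X]

lemma QAenv_le_of_tsupport_subset [FiniteDimensional ℝ W] {k l : ℕ} (hk : 1 ≤ k) (hl : 1 ≤ l)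
    {Acoef : (Fin n → ℕ) → (W →ₗ[ℝ] X)} {Bcoef : (Fin n → ℕ) → (V →ₗ[ℝ] W)}
    (hexact : ∀ ξ : Fin n → ℝ, ξ ≠ 0 →
      LinearMap.ker (symbolOf k Acoef ξ) = LinearMap.range (symbolOf l Bcoef ξ))
    (f : W → ℝ) (η : W) {u : (Fin n → ℝ) → V} (hc : ContDiff ℝ (⊤ : ℕ∞) u)
    (hu : tsupport u ⊆ openUnitCube n) :
    QAenv (k := k) Acoef f η
      ≤ ((∫ x in Set.Icc (0 : Fin n → ℝ) 1, f (η + diffOp l Bcoef u x) : ℝ) : EReal) := by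
  obtain ⟨v, hvc, hv, hvu⟩ := exists_periodization hc hu
  refine sInf_le ⟨diffOp l Bcoef v, hvc.diffOp l Bcoef, hv.diffOp l Bcoef,
    diffOp_diffOp_eq_zero hk hexact hvc hv, setIntegral_diffOp_eq_zero hl hvc hv, ?_⟩
  congr 1
  rw [← setIntegral_congr_set (openUnitCube_ae_eq_Icc n),
    ← setIntegral_congr_set (openUnitCube_ae_eq_Icc n)]
  refine setIntegral_congr_fun (isOpen_openUnitCube n).measurableSet fun x hx => ?_
  simp only [diffOp_congr_nhds (hvu x hx)]

/-- The cube `(δ, 1 - δ)ⁿ`. -/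
def innerCube (n : ℕ) (δ : ℝ) : Set (Fin n → ℝ) := Set.univ.pi fun _ => Set.Ioo δ (1 - δ)

lemma measurableSet_innerCube (n : ℕ) (δ : ℝ) : MeasurableSet (innerCube n δ) :=
  (isOpen_set_pi Set.finite_univ fun _ _ => isOpen_Ioo).measurableSet

lemma volume_Icc_diff_innerCube (n : ℕ) {δ : ℝ} (h0 : 0 ≤ δ) (h1 : 2 * δ ≤ 1) :
    volume.real (Set.Icc (0 : Fin n → ℝ) 1 \ innerCube n δ) = 1 - (1 - 2 * δ) ^ n := by
  have hsub : innerCube n δ ⊆ Set.Icc (0 : Fin n → ℝ) 1 := fun x hx =>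
    ⟨fun i => h0.trans (hx i trivial).1.le,
      fun i => (hx i trivial).2.le.trans (by simpa using h0)⟩
  have hfin : volume (Set.Icc (0 : Fin n → ℝ) 1) ≠ ⊤ := isCompact_Icc.measure_ne_top
  rw [measureReal_sdiff hsub (measurableSet_innerCube n δ) hfin]
  congr 1
  · simp [Measure.real, Real.volume_Icc_pi]
  · rw [innerCube, Measure.real, Real.volume_pi_Ioo_toReal (fun i => by linarith)]
    rw [Finset.prod_const, Finset.card_univ, Fintype.card_fin]
    ring

lemma ZPeriodic.setIntegral_comp_nsmul {W : Type*} [NormedAddCommGroup W] [MeasurableSpace W]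
    [BorelSpace W] {w : (Fin n → ℝ) → W} (hw : ZPeriodic w) (hc : Continuous w) {f : W → ℝ}
    (hf : Measurable f) {N : ℕ} (hN : N ≠ 0) :
    ∫ x in Set.Icc (0 : Fin n → ℝ) 1, f (w ((N : ℝ) • x))
      = ∫ x in Set.Icc (0 : Fin n → ℝ) 1, f (w x) := by
  obtain ⟨w', hw'c, hw'⟩ := hw.exists_torus_lift hc
  have hm : AEStronglyMeasurable (fun t => f (w' t)) volume :=
    (hf.comp hw'c.measurable).aestronglyMeasurable
  simp only [← hw']
  rw [setIntegral_comp_toTorus_nsmul hm hN, setIntegral_comp_toTorus hm]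

lemma abs_setIntegral_sub_le {F G : (Fin n → ℝ) → ℝ} (hF : Measurable F) (hG : Measurable G)
    {M : ℝ} (hFM : ∀ x, |F x| ≤ M) (hGM : ∀ x, |G x| ≤ M) {S : Set (Fin n → ℝ)}
    (hFG : Set.EqOn F G S) :
    |(∫ x in Set.Icc (0 : Fin n → ℝ) 1, F x) - ∫ x in Set.Icc (0 : Fin n → ℝ) 1, G x|
      ≤ 2 * M * volume.real (Set.Icc (0 : Fin n → ℝ) 1 \ S) := by
  have hfin : volume (Set.Icc (0 : Fin n → ℝ) 1) ≠ ⊤ := isCompact_Icc.measure_ne_top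
  have h_int : ∀ {H : (Fin n → ℝ) → ℝ}, Measurable H → (∀ x, |H x| ≤ M) →
      IntegrableOn H (Set.Icc (0 : Fin n → ℝ) 1) := fun hH hM =>
    Measure.integrableOn_of_bounded hfin hH.aestronglyMeasurable (Filter.Eventually.of_forall hM)
  rw [← integral_sub (h_int hF hFM) (h_int hG hGM),
    setIntegral_eq_of_subset_of_forall_sdiff_eq_zero measurableSet_Icc
      (Set.sdiff_subset (t := S)) fun x hx => by
        rw [Set.sdiff_sdiff_right_self] at hx
        rw [hFG hx.2, sub_self]]
  rw [← Real.norm_eq_abs]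
  exact norm_setIntegral_le_of_norm_le_const (μ := volume) (f := fun x => F x - G x)
    ((measure_mono Set.sdiff_subset).trans_lt hfin.lt_top) fun x _ =>
      (norm_sub_le (F x) (G x)).trans (by
        rw [Real.norm_eq_abs, Real.norm_eq_abs]
        linarith [hFM x, hGM x])

/-- Rescaling and truncating a periodic potential gives test functions with small Hölder norm
and almost the same energy. -/
lemma exists_test_function [MeasurableSpace W] [BorelSpace W] {l : ℕ} (hl : 1 ≤ l)
    (Bcoef : (Fin n → ℕ) → (V →ₗ[ℝ] W)) {f : W → ℝ} (hf_meas : Measurable f)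
    (hf_locbdd : ∀ R : ℝ, ∃ C : ℝ, ∀ η : W, ‖η‖ ≤ R → |f η| ≤ C)
    {a : ℝ} (ha0 : 0 ≤ a) (ha1 : a < 1) (η : W) {ε : ℝ} (hε : 0 < ε) {δ : ℝ} (hδ : 0 < δ)
    {v : (Fin n → ℝ) → V} (hvc : ContDiff ℝ (⊤ : ℕ∞) v) (hv : ZPeriodic v) :
    ∃ u : (Fin n → ℝ) → V, ContDiff ℝ (⊤ : ℕ∞) u ∧ tsupport u ⊆ openUnitCube n ∧
      holderNorm l a (fun x : EuclideanSpace ℝ (Fin n) => u x) < ε ∧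
      (∫ x in Set.Icc (0 : Fin n → ℝ) 1, f (η + diffOp l Bcoef u x))
        ≤ (∫ x in Set.Icc (0 : Fin n → ℝ) 1, f (η + diffOp l Bcoef v x)) + δ := by
  obtain ⟨ψ, hψ, hψ0, hψ1⟩ := exists_cutoff n
  have hh : UniformlySmooth fun N y => ψ N y • v y :=
    hψ.smul ((hv.uniformlySmooth hvc).reindex fun _ : ℕ => ())
  have hH := hh.comp_clm (EuclideanSpace.equiv (Fin n) ℝ : EuclideanSpace ℝ (Fin n) →L[ℝ] _)
  obtain ⟨C₁, hC₁⟩ := hh.exists_norm_diffOp_le l Bcoef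
  have hwc : Continuous (diffOp l Bcoef v) := (hvc.diffOp l Bcoef).continuous
  obtain ⟨C₂, -, hC₂⟩ := (hv.diffOp l Bcoef).exists_norm_le hwc
  obtain ⟨M, hM⟩ := hf_locbdd (‖η‖ + max C₁ C₂)
  have hfM : ∀ y, ‖y‖ ≤ max C₁ C₂ → |f (η + y)| ≤ M := fun y hy =>
    hM _ ((norm_add_le _ _).trans (by linarith))
  have hlim : Filter.Tendsto (fun N : ℕ => 2 * M * (1 - (1 - 2 * (N : ℝ)⁻¹) ^ n))
      Filter.atTop (nhds 0) := by
    have h1 : Filter.Tendsto (fun N : ℕ => (N : ℝ)⁻¹) Filter.atTop (nhds 0) :=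
      tendsto_inv_atTop_nhds_zero_nat
    have h2 := (((h1.const_mul 2).const_sub 1).pow n).const_sub 1 |>.const_mul (2 * M)
    simpa using h2
  obtain ⟨N, hNε, hNδ, hN2⟩ := ((eventually_holderNorm_lt hl ha0 ha1 hH hε).and
    ((hlim.eventually_lt_const hδ).and (Filter.eventually_ge_atTop 2))).exists
  have hNr : (2 : ℝ) ≤ N := by exact_mod_cast hN2
  have hN0 : (0 : ℝ) < N := by linarith
  have hB : ∀ x, diffOp l Bcoef
      (fun x => ((N : ℝ) ^ l)⁻¹ • (ψ N ((N : ℝ) • x) • v ((N : ℝ) • x))) x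
      = diffOp l Bcoef (fun y => ψ N y • v y) ((N : ℝ) • x) := fun x => by
    rw [diffOp_rescale (hh.1 N), inv_mul_cancel₀ (by positivity), one_smul]
  have huc : ContDiff ℝ (⊤ : ℕ∞)
      fun x => ((N : ℝ) ^ l)⁻¹ • (ψ N ((N : ℝ) • x) • v ((N : ℝ) • x)) :=
    contDiff_const.smul ((hh.1 N).comp (contDiff_const_smul (N : ℝ)))
  refine ⟨fun x => ((N : ℝ) ^ l)⁻¹ • (ψ N ((N : ℝ) • x) • v ((N : ℝ) • x)), huc, ?_, hNε, ?_⟩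
  · have hsub : tsupport (fun x => ((N : ℝ) ^ l)⁻¹ • (ψ N ((N : ℝ) • x) • v ((N : ℝ) • x)))
        ⊆ Set.Icc (fun _ => 1 / (2 * N)) fun _ => 1 - 1 / (2 * N) := by
      refine closure_minimal (fun x hx => ?_) isClosed_Icc
      have hx' := hψ0 N ((N : ℝ) • x) fun h => hx (by simp [h])
      simp only [Pi.smul_apply, smul_eq_mul] at hx'
      have he : (N : ℝ) * (1 / (2 * N)) = 1 / 2 := by field_simp
      exact ⟨fun i => le_of_mul_le_mul_left (by linarith [(hx' i).1]) hN0,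
        fun i => le_of_mul_le_mul_left (by linarith [(hx' i).2]) hN0⟩
    refine hsub.trans fun x hx i _ => ?_
    have : (0 : ℝ) < 1 / (2 * N) := by positivity
    exact ⟨this.trans_le (hx.1 i), (hx.2 i).trans_lt (by simpa using hN0)⟩
  · have hw : ZPeriodic fun x => η + diffOp l Bcoef v x := fun x z => by
      simp only [hv.diffOp l Bcoef x z]
    have hEq : Set.EqOn (fun x => f (η + diffOp l Bcoef
        (fun x => ((N : ℝ) ^ l)⁻¹ • (ψ N ((N : ℝ) • x) • v ((N : ℝ) • x))) x))
        (fun x => f (η + diffOp l Bcoef v ((N : ℝ) • x))) (innerCube n (N : ℝ)⁻¹) := by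
      intro x hx
      have hev : (fun y => ψ N y • v y) =ᶠ[nhds ((N : ℝ) • x)] v := by
        have hopen : IsOpen (Set.univ.pi fun _ : Fin n => Set.Ioo (1 : ℝ) (N - 1)) :=
          isOpen_set_pi Set.finite_univ fun _ _ => isOpen_Ioo
        have hmem : (N : ℝ) • x ∈ Set.univ.pi fun _ : Fin n => Set.Ioo (1 : ℝ) (N - 1) := by
          intro i _
          have h1 := mul_lt_mul_of_pos_left (hx i trivial).1 hN0
          have h2 := mul_lt_mul_of_pos_left (hx i trivial).2 hN0
          rw [mul_inv_cancel₀ hN0.ne'] at h1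
          rw [mul_sub, mul_inv_cancel₀ hN0.ne', mul_one] at h2
          exact ⟨h1, h2⟩
        filter_upwards [hopen.mem_nhds hmem] with y hy
        rw [hψ1 N y fun i => ⟨(hy i trivial).1.le, (hy i trivial).2.le⟩, one_smul]
      simp only [hB, diffOp_congr_nhds hev]
    have hmeas : ∀ {w : (Fin n → ℝ) → W}, Continuous w → Measurable fun x => f (η + w x) :=
      fun hw => hf_meas.comp (continuous_const.add hw).measurable
    have habs := abs_setIntegral_sub_le
      (hmeas (huc.diffOp l Bcoef).continuous)
      (hmeas (hwc.comp (continuous_const_smul (N : ℝ))))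
      (fun x => hfM _ (by rw [hB]; exact (hC₁ N _).trans (le_max_left _ _)))
      (fun x => hfM _ ((hC₂ _).trans (le_max_right _ _)))
      hEq
    rw [volume_Icc_diff_innerCube n (by positivity)
      (by rw [← div_eq_mul_inv, div_le_one hN0]; exact hNr)] at habs
    have hper := hw.setIntegral_comp_nsmul (continuous_const.add hwc) hf_meas
      (N := N) (by omega)
    have := (abs_le.1 habs).2
    simp only [Function.comp_apply] at this
    linarith

end Envelope

/-- **Equation (3.2): testing with potentials of small `C^{l−1,α}` norm.** Under the
assumptions of Corollary 3.2 and for any `α ∈ [0,1)` and `ε > 0`, the `A`-quasiconvex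
envelope `Q_A f(η)` equals the infimum of `∫_{[0,1]^n} f(η + B u)` over
`u ∈ C_c^∞((0,1)^n, V)` with `‖u‖_{C^{l−1,α}} < ε`. -/
theorem QAenv_eq_inf_small_holder_norm
    {n k l : ℕ} (hn : 1 ≤ n) (hk : 1 ≤ k) (hl : 1 ≤ l)
    {V W X : Type*}
    [NormedAddCommGroup V] [InnerProductSpace ℝ V] [FiniteDimensional ℝ V]
    [NormedAddCommGroup W] [InnerProductSpace ℝ W] [FiniteDimensional ℝ W]
    [MeasurableSpace W] [BorelSpace W]
    [NormedAddCommGroup X] [InnerProductSpace ℝ X] [FiniteDimensional ℝ X]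
    (Acoef : (Fin n → ℕ) → (W →ₗ[ℝ] X)) (Bcoef : (Fin n → ℕ) → (V →ₗ[ℝ] W))
    (hArank : ∃ r : ℕ, ∀ ξ : Fin n → ℝ, ξ ≠ 0 →
      Module.finrank ℝ (LinearMap.range (symbolOf k Acoef ξ)) = r)
    (hBrank : ∃ s : ℕ, ∀ ξ : Fin n → ℝ, ξ ≠ 0 →
      Module.finrank ℝ (LinearMap.range (symbolOf l Bcoef ξ)) = s)
    (hexact : ∀ ξ : Fin n → ℝ, ξ ≠ 0 →
      LinearMap.ker (symbolOf k Acoef ξ) = LinearMap.range (symbolOf l Bcoef ξ))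
    (f : W → ℝ) (hf_meas : Measurable f)
    (hf_locbdd : ∀ R : ℝ, ∃ C : ℝ, ∀ η : W, ‖η‖ ≤ R → |f η| ≤ C)
    (a : ℝ) (ha0 : 0 ≤ a) (ha1 : a < 1) :
    ∀ (η : W) (ε : ℝ), 0 < ε →
      QAenv (k := k) Acoef f η
        = sInf {y : EReal | ∃ u : (Fin n → ℝ) → V, ContDiff ℝ (⊤ : ℕ∞) u ∧
            tsupport u ⊆ openUnitCube n ∧
            holderNorm l a (fun x : EuclideanSpace ℝ (Fin n) => u x) < ε ∧
            y = ((∫ x in Set.Icc (0 : Fin n → ℝ) 1, f (η + diffOp l Bcoef u x)) : ℝ)} := by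
  intro η ε hε
  refine le_antisymm (le_sInf ?_) (le_sInf ?_)
  · rintro y ⟨u, hc, hu, -, rfl⟩
    exact QAenv_le_of_tsupport_subset hk hl hexact f η hc hu
  · rintro y ⟨w, hwc, hw, hA, h_int, rfl⟩
    obtain ⟨v, hvc, hv, hvw⟩ := exists_potential hBrank hexact hwc hw hA h_int
    obtain rfl : diffOp l Bcoef v = w := funext hvw
    by_contra! hlt
    obtain ⟨c, hc1, hc2⟩ := EReal.lt_iff_exists_real_btwn.1 hlt
    obtain ⟨u, huc, hu, huε, hle⟩ := exists_test_function hl Bcoef hf_meas hf_locbdd ha0 ha1 η hε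
      (sub_pos.2 (EReal.coe_lt_coe_iff.1 hc1)) hvc hv
    rw [add_sub_cancel] at hle
    exact absurd hc2 (not_lt.2 (le_trans (sInf_le ⟨u, huc, hu, huε, rfl⟩)
      (EReal.coe_le_coe_iff.2 hle)))
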